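/- Assume the Riemann Hypothesis. Fix ε > 0, c₂ ∈ (1,2), and a weight W as described. Then there exists a constant C > 0 (depending only on ε, c₂ and W) such that for all large real numbers x, y with y ≥ x², one has |C(x,y) − (y x²/ζ(2)) · Ŵ(1) · (1/(2πi)) ∫_{Re s = c₂} Ŵ(2−s) Ŵ(s) ds| ≤ C ( y x^{1/2+ε} + y^{ε} x^{4−2ε} ). -/

import Mathlib

open Complex Filter

/-- The Ramanujan sum `c_q(n) = ∑_{a mod q, gcd(a,q)=1} e(na/q)`. -/
noncomputable def ramanujanSum (q n : ℕ) : ℂ :=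
  ∑ a ∈ (Finset.range q).filter (fun a => Nat.Coprime a q),
    Complex.exp (2 * Real.pi * Complex.I * (((n * a : ℕ) : ℂ) / (q : ℂ)))

/-- A smooth weight function attached to a parameter `U ≥ 2`: `0 ≤ W ≤ 1`, supported in
`[1/(2U), 1 + 1/(2U)]`, equal to `1` on `[1/U, 1]`, with `j`-th derivative `≪_j U^j`. -/
structure Weight (U : ℝ) : Type where
  toFun : ℝ → ℝ
  smooth : ContDiff ℝ (⊤ : ℕ∞) toFun
  nonneg : ∀ t, 0 ≤ toFun t
  le_one : ∀ t, toFun t ≤ 1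
  support_subset : ∀ t, t ∉ Set.Icc (1 / (2 * U)) (1 + 1 / (2 * U)) → toFun t = 0
  eq_one : ∀ t ∈ Set.Icc (1 / U) 1, toFun t = 1
  deriv_bound : ∀ j : ℕ, ∃ Cj : ℝ, ∀ t, |iteratedDeriv j toFun t| ≤ Cj * U ^ j

/-- The Mellin transform `Ŵ(s) = ∫_0^∞ W(t) t^{s-1} dt`. -/
noncomputable def mellinW (W : ℝ → ℝ) (s : ℂ) : ℂ :=
  ∫ t in Set.Ioi (0 : ℝ), (W t : ℂ) * (t : ℂ) ^ (s - 1)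

/-- `(1/(2πi)) ∫_{Re s = c} f(s) ds`, the normalized vertical line integral. -/
noncomputable def VI (c : ℝ) (f : ℂ → ℂ) : ℂ :=
  (1 / (2 * Real.pi * Complex.I)) * ∫ t : ℝ, f (c + t * Complex.I) * Complex.I

/-- The smoothed second moment `C(x,y) = ∑_n (∑_q c_q(n) W(q/x))² W(n/y)`. -/
noncomputable def Cxy {U : ℝ} (W : Weight U) (x y : ℝ) : ℂ :=
  ∑' n : ℕ+, (∑' q : ℕ+, ramanujanSum q n * (W.toFun ((q : ℕ) / x) : ℂ)) ^ 2
    * (W.toFun ((n : ℕ) / y) : ℂ)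

/-- The generalized divisor sum `σ_z(n) = ∑_{d ∣ n} d^z`. -/
noncomputable def sigmaC (z : ℂ) (n : ℕ) : ℂ := ∑ d ∈ n.divisors, (d : ℂ) ^ z

/-- The fractional part, restricted to `(1, ∞)`. -/
noncomputable def fractTail (t : ℝ) : ℂ :=
  Set.indicator (Set.Ioi 1) (fun t => ((Int.fract t : ℝ) : ℂ)) t

lemma norm_fractTail_le (t : ℝ) : ‖fractTail t‖ ≤ 1 := by
  unfold fractTail
  by_cases h : t ∈ Set.Ioi (1 : ℝ)
  · rw [Set.indicator_of_mem h, Complex.norm_real, Real.norm_eq_abs,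
      abs_of_nonneg (Int.fract_nonneg t)]
    exact (Int.fract_lt_one t).le
  · simp [Set.indicator_of_notMem h]

lemma measurable_fractTail : Measurable fractTail :=
  (Complex.measurable_ofReal.comp measurable_fract).indicator measurableSet_Ioi

lemma locallyIntegrable_fractTail : MeasureTheory.LocallyIntegrable fractTail := by
  have h1 : MeasureTheory.LocallyIntegrable (fun _ : ℝ => (1 : ℝ)) :=
    continuous_const.locallyIntegrable
  refine h1.mono measurable_fractTail.aestronglyMeasurable (Eventually.of_forall fun t => ?_)
  simpa using norm_fractTail_le t

lemma differentiableAt_mellin_fractTail {s : ℂ} (hs : s.re < 0) :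
    DifferentiableAt ℂ (mellin fractTail) s := by
  refine mellin_differentiableAt_of_isBigO_rpow (a := 0) (b := s.re - 1)
    (locallyIntegrable_fractTail.locallyIntegrableOn _) ?_ (by simpa using hs) ?_ (by simp)
  · refine Asymptotics.IsBigO.of_bound 1 (Eventually.of_forall fun t => ?_)
    simpa using norm_fractTail_le t
  · refine (Asymptotics.isBigO_zero _ _).congr' ?_ EventuallyEq.rfl
    filter_upwards [Ioo_mem_nhdsGT (zero_lt_one' ℝ)] with t ht
    have : t ∉ Set.Ioi (1 : ℝ) := by simpa using ht.2.le
    simp [fractTail, this]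

lemma mellin_fractTail_eq (s : ℂ) :
    mellin fractTail (-s) = ∫ t in Set.Ioi (1 : ℝ), ((Int.fract t : ℝ) : ℂ) * (t : ℂ) ^ (-(s + 1)) := by
  have h : ∀ t : ℝ, (t : ℂ) ^ (-s - 1) • fractTail t = Set.indicator (Set.Ioi 1)
      (fun t : ℝ => ((Int.fract t : ℝ) : ℂ) * (t : ℂ) ^ (-(s + 1))) t := by
    intro t
    unfold fractTail
    by_cases h : t ∈ Set.Ioi (1 : ℝ)
    · simp only [Set.indicator_of_mem h, smul_eq_mul]
      rw [mul_comm]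
      congr 2
      ring
    · simp [Set.indicator_of_notMem h]
  unfold mellin
  simp_rw [h]
  rw [MeasureTheory.setIntegral_indicator measurableSet_Ioi]
  congr 2
  ext t
  simp only [Set.mem_inter_iff, Set.mem_Ioi]
  exact ⟨fun h => h.2, fun h => ⟨zero_lt_one.trans h, h⟩⟩

lemma norm_mellin_fractTail_le {s : ℂ} (hs : 0 < s.re) :
    ‖mellin fractTail (-s)‖ ≤ 1 / s.re := by
  rw [mellin_fractTail_eq]
  have h1 : ∫ t in Set.Ioi (1 : ℝ), t ^ (-(s.re + 1)) = 1 / s.re := by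
    rw [integral_Ioi_rpow_of_lt (by linarith) zero_lt_one]
    simp
  rw [← h1]
  refine MeasureTheory.norm_integral_le_of_norm_le
    (integrableOn_Ioi_rpow_of_lt (by linarith) zero_lt_one) ?_
  refine (MeasureTheory.ae_restrict_mem measurableSet_Ioi).mono fun t ht => ?_
  have ht0 : 0 < t := zero_lt_one.trans ht
  rw [norm_mul, Complex.norm_cpow_eq_rpow_re_of_pos ht0, Complex.norm_real, Real.norm_eq_abs,
    abs_of_nonneg (Int.fract_nonneg t)]
  have : (-(s + 1)).re = -(s.re + 1) := by simp
  rw [this]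
  have h2 := Real.rpow_nonneg ht0.le (-(s.re + 1))
  nlinarith [(Int.fract_lt_one t)]

lemma riemannZeta_eq_of_one_lt_re {s : ℂ} (hs : 1 < s.re) :
    riemannZeta s = s / (s - 1) - s * mellin fractTail (-s) := by
  have hO : (fun n : ℕ ↦ ∑ k ∈ Finset.Icc 1 n, ‖(1 : ℕ → ℂ) k‖) =O[atTop] fun n ↦ (n : ℝ) ^ (1 : ℝ) := by
    simpa using Asymptotics.isBigO_refl _ _
  have h := LSeries_eq_mul_integral' (1 : ℕ → ℂ) zero_le_one hs hO
  rw [LSeries_one_eq_riemannZeta hs] at h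
  rw [h, mellin_fractTail_eq, div_eq_mul_inv, ← mul_sub]
  congr 1
  have hi1 : MeasureTheory.IntegrableOn (fun t : ℝ => (t : ℂ) ^ (-s)) (Set.Ioi 1) :=
    integrableOn_Ioi_cpow_of_lt (by simpa using hs) zero_lt_one
  have hi2 : MeasureTheory.IntegrableOn
      (fun t : ℝ => ((Int.fract t : ℝ) : ℂ) * (t : ℂ) ^ (-(s + 1))) (Set.Ioi 1) := by
    have h3 : MeasureTheory.IntegrableOn (fun t : ℝ => (t : ℂ) ^ (-(s + 1))) (Set.Ioi 1) :=
      integrableOn_Ioi_cpow_of_lt (by simp; linarith) zero_lt_one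
    refine h3.bdd_mul (c := 1)
      (Complex.measurable_ofReal.comp measurable_fract).aestronglyMeasurable
      (Eventually.of_forall fun t => ?_)
    rw [Complex.norm_real, Real.norm_eq_abs, abs_of_nonneg (Int.fract_nonneg t)]
    exact (Int.fract_lt_one t).le
  have h4 : (s - 1)⁻¹ = ∫ t in Set.Ioi (1 : ℝ), (t : ℂ) ^ (-s) := by
    rw [integral_Ioi_cpow_of_lt (by simpa using hs) zero_lt_one]
    have : s - 1 ≠ 0 := fun h0 => by
      have : s = 1 := by linear_combination h0
      simp [this] at hs
    have h' : -s + 1 ≠ 0 := fun h0 => this (by linear_combination -h0)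
    simp
    field_simp
    ring
  rw [h4, ← MeasureTheory.integral_sub hi1 hi2]
  refine MeasureTheory.setIntegral_congr_fun measurableSet_Ioi fun t ht => ?_
  have ht0 : (0 : ℝ) < t := zero_lt_one.trans ht
  have hf : ((⌊t⌋₊ : ℕ) : ℂ) = (t : ℂ) - ((Int.fract t : ℝ) : ℂ) := by
    have : ((⌊t⌋₊ : ℕ) : ℝ) = t - Int.fract t := by
      rw [natCast_floor_eq_intCast_floor ht0.le, Int.self_sub_fract]
    exact_mod_cast congrArg (fun r : ℝ => (r : ℂ)) this
  simp only [Pi.one_apply, Finset.sum_const, Nat.card_Icc, Nat.add_sub_cancel, nsmul_eq_mul,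
    mul_one]
  rw [hf, sub_mul]
  congr 1
  have ht' : (t : ℂ) ≠ 0 := by exact_mod_cast ht0.ne'
  rw [show -s = 1 + -(s + 1) by ring, Complex.cpow_add _ _ ht', Complex.cpow_one]

lemma riemannZeta₁_eq {s : ℂ} (hs : 0 < s.re) :
    riemannZeta₁ s = s - s * (s - 1) * mellin fractTail (-s) := by
  have hopen : IsOpen {z : ℂ | 0 < z.re} := isOpen_lt continuous_const Complex.continuous_re
  have hconv : IsPreconnected {z : ℂ | 0 < z.re} :=
    (convex_halfSpace_re_gt 0).isPreconnected
  have hf : AnalyticOnNhd ℂ riemannZeta₁ {z : ℂ | 0 < z.re} :=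
    (differentiable_riemannZeta₁.differentiableOn).analyticOnNhd hopen
  have hg : AnalyticOnNhd ℂ (fun s => s - s * (s - 1) * mellin fractTail (-s))
      {z : ℂ | 0 < z.re} := by
    refine DifferentiableOn.analyticOnNhd (fun z hz => ?_) hopen
    have : DifferentiableAt ℂ (fun s => mellin fractTail (-s)) z :=
      (differentiableAt_mellin_fractTail (s := -z) (by simpa using hz)).comp z
        differentiableAt_id.neg
    exact (by fun_prop : DifferentiableAt ℂ
      (fun s => s - s * (s - 1) * mellin fractTail (-s)) z).differentiableWithinAt
  refine hf.eqOn_of_preconnected_of_eventuallyEq hg hconv (z₀ := 2) (by simp) ?_ hs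
  have h2 : {z : ℂ | 1 < z.re} ∈ nhds (2 : ℂ) :=
    (isOpen_lt continuous_const Complex.continuous_re).mem_nhds (by simp)
  filter_upwards [h2] with z hz
  have hz1 : z ≠ 1 := by rintro rfl; simp at hz
  have hz1' : z - 1 ≠ 0 := sub_ne_zero.mpr hz1
  have h := riemannZeta_eq_inv_sub_mul hz1
  rw [riemannZeta_eq_of_one_lt_re hz] at h
  field_simp at h
  rw [← h]; ring

lemma norm_riemannZeta₁_le {s : ℂ} (hs : 1 / 2 ≤ s.re) :
    ‖riemannZeta₁ s‖ ≤ 3 * (1 + ‖s‖) ^ 2 := by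
  rw [riemannZeta₁_eq (by linarith)]
  have h1 : ‖mellin fractTail (-s)‖ ≤ 2 :=
    (norm_mellin_fractTail_le (by linarith)).trans (by
      rw [div_le_iff₀ (by linarith)]; linarith)
  have h2 : ‖s - 1‖ ≤ ‖s‖ + 1 := (norm_sub_le _ _).trans (by simp)
  calc _ ≤ ‖s‖ + ‖s * (s - 1) * mellin fractTail (-s)‖ := norm_sub_le _ _
    _ = ‖s‖ + ‖s‖ * ‖s - 1‖ * ‖mellin fractTail (-s)‖ := by simp
    _ ≤ ‖s‖ + ‖s‖ * (‖s‖ + 1) * 2 := by gcongr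
    _ ≤ _ := by nlinarith [norm_nonneg s]

/-- A nonvanishing holomorphic function on a disc which is bounded above is bounded below on
smaller discs, by the Borel–Carathéodory theorem applied to its logarithm. -/
lemma norm_center_le_of_ne_zero_on_ball {f : ℂ → ℂ} {s₀ z : ℂ} {R r A c : ℝ} {K : ℕ}
    (hf : Differentiable ℂ f) (hR : 0 < R) (hne : ∀ w ∈ Metric.ball s₀ R, f w ≠ 0)
    (hA : ∀ w ∈ Metric.ball s₀ R, ‖f w‖ ≤ A) (hc : 0 < c) (hcA : c < A) (hc₀ : c ≤ ‖f s₀‖)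
    (hr : r < R) (hz : ‖z - s₀‖ ≤ r) (hK : 2 * r / (R - r) ≤ K) :
    c ≤ (A / c) ^ K * ‖f z‖ := by
  have hs₀ : s₀ ∈ Metric.ball s₀ R := Metric.mem_ball_self hR
  have hd : DifferentiableOn ℂ (fun w => deriv f w / f w) (Metric.ball s₀ R) := by
    refine DifferentiableOn.div ?_ hf.differentiableOn hne
    exact (hf.deriv).differentiableOn
  obtain ⟨L, hL0, hL⟩ := hd.isExactOn_ball.with_val_at s₀ 0
  have hconst : ∀ w ∈ Metric.ball s₀ R, f w * Complex.exp (-L w) = f s₀ := by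
    intro w hw
    have hder : ∀ u ∈ Metric.ball s₀ R,
        HasDerivAt (fun w => f w * Complex.exp (-L w)) 0 u := by
      intro u hu
      have h1 := (hf u).hasDerivAt.mul ((hL u hu).neg.cexp)
      refine h1.congr_deriv ?_
      have hu' := hne u hu
      have h2 : f u * (deriv f u / f u) = deriv f u := mul_div_cancel₀ _ hu'
      linear_combination (-Complex.exp (-L u)) * h2
    have := Metric.isOpen_ball.is_const_of_deriv_eq_zero
      (convex_ball s₀ R).isPreconnected
      (fun u hu => (hder u hu).differentiableAt.differentiableWithinAt)
      (fun u hu => (hder u hu).deriv) hw hs₀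
    simpa [hL0] using this
  have hnorm : ∀ w ∈ Metric.ball s₀ R, ‖f w‖ = ‖f s₀‖ * Real.exp (L w).re := by
    intro w hw
    rw [← hconst w hw, norm_mul, Complex.norm_exp, mul_assoc, ← Real.exp_add]
    simp
  have hAc : 1 < A / c := (one_lt_div hc).mpr hcA
  have hM : 0 < Real.log (A / c) := Real.log_pos hAc
  have hball : ∀ w ∈ Metric.ball (0 : ℂ) R, s₀ + w ∈ Metric.ball s₀ R := by
    intro w hw
    simpa using hw
  have hzb : z ∈ Metric.ball s₀ R := by
    rw [mem_ball_iff_norm]; linarith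
  have hBC := Complex.borelCaratheodory_zero (f := fun w => L (s₀ + w)) (z := z - s₀) (R := R) hM
    (fun w hw => by
      have h1 := (hL _ (hball w hw)).differentiableAt
      exact (h1.comp w (by fun_prop)).differentiableWithinAt)
    (fun w hw => by
      have hw' := hball w hw
      have h2 : 0 < ‖f s₀‖ := hc.trans_le hc₀
      have h3 : Real.exp (L (s₀ + w)).re ≤ A / c := by
        rw [le_div_iff₀ hc]
        calc _ ≤ Real.exp (L (s₀ + w)).re * ‖f s₀‖ := by gcongr
          _ = ‖f (s₀ + w)‖ := by rw [hnorm _ hw']; ring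
          _ ≤ A := hA _ hw'
      exact (Real.le_log_iff_exp_le (by linarith)).mpr h3)
    hR (by rw [mem_ball_zero_iff]; linarith) (by simpa using hL0)
  simp only [add_sub_cancel] at hBC
  have h0 : 0 ≤ ‖z - s₀‖ := norm_nonneg _
  have hLz : ‖L z‖ ≤ K * Real.log (A / c) := by
    refine hBC.trans ?_
    calc 2 * Real.log (A / c) * ‖z - s₀‖ / (R - ‖z - s₀‖)
        ≤ 2 * Real.log (A / c) * r / (R - r) := by
          have hr0 : 0 ≤ r := h0.trans hz
          gcongr
      _ = (2 * r / (R - r)) * Real.log (A / c) := by ring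
      _ ≤ _ := by gcongr
  have hre : -(K * Real.log (A / c)) ≤ (L z).re :=
    (neg_le_neg hLz).trans ((abs_le.mp (Complex.abs_re_le_norm (L z))).1)
  rw [hnorm z hzb]
  have hpow : (A / c) ^ K = Real.exp (K * Real.log (A / c)) := by
    rw [mul_comm, Real.exp_mul, Real.exp_log (by linarith), Real.rpow_natCast]
  calc c ≤ ‖f s₀‖ * 1 := by linarith
    _ ≤ ‖f s₀‖ * ((A / c) ^ K * Real.exp (L z).re) := by
        gcongr
        rw [hpow, ← Real.exp_add]
        exact Real.one_le_exp (by linarith)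
    _ = _ := by ring

lemma exists_le_norm_riemannZeta₁_two_add :
    ∃ c : ℝ, 0 < c ∧ c ≤ 1 ∧ ∀ t : ℝ, c ≤ ‖riemannZeta₁ (2 + t * I)‖ := by
  set a : ℕ → ℂ := fun n => (ArithmeticFunction.moebius n : ℂ) with ha
  have hsum : LSeriesSummable a 2 :=
    ArithmeticFunction.LSeriesSummable_moebius_iff.mpr (by simp)
  set B : ℝ := ∑' n, ‖LSeries.term a 2 n‖ with hB
  have hB0 : 0 ≤ B := tsum_nonneg fun _ => norm_nonneg _
  refine ⟨1 / (1 + B), by positivity, by rw [div_le_one (by positivity)]; linarith, fun t => ?_⟩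
  have hre : (2 + t * I : ℂ).re = 2 := by simp
  have hre' : 1 < (2 + t * I : ℂ).re := by rw [hre]; norm_num
  have hle : ‖LSeries a (2 + t * I)‖ ≤ B := by
    have hterm : ∀ n, ‖LSeries.term a (2 + t * I) n‖ = ‖LSeries.term a 2 n‖ := by
      intro n
      rw [LSeries.norm_term_eq, LSeries.norm_term_eq, hre]
      simp
    rw [LSeries, hB]
    simp_rw [← hterm]
    refine norm_tsum_le_tsum_norm ?_
    simp_rw [hterm]
    exact hsum.norm
  have hmul := LSeries_one_mul_Lseries_moebius hre'
  rw [LSeries_one_eq_riemannZeta hre'] at hmul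
  have hne : (2 + t * I : ℂ) ≠ 1 := by
    intro h; rw [h] at hre'; simp at hre'
  have h1 : ‖riemannZeta (2 + t * I)‖ * ‖LSeries a (2 + t * I)‖ = 1 := by
    rw [← norm_mul, hmul, norm_one]
  have h2 : (1 : ℝ) ≤ ‖(2 + t * I : ℂ) - 1‖ := by
    refine le_trans ?_ (Complex.abs_re_le_norm _)
    simp; norm_num
  have h3 : riemannZeta₁ (2 + t * I) = (2 + t * I - 1) * riemannZeta (2 + t * I) := by
    rw [riemannZeta_eq_inv_sub_mul hne]
    field_simp [sub_ne_zero.mpr hne]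
  rw [h3, norm_mul, div_le_iff₀ (by positivity)]
  have h4 : 0 ≤ ‖riemannZeta (2 + t * I)‖ := norm_nonneg _
  calc (1 : ℝ) = 1 * (‖riemannZeta (2 + t * I)‖ * ‖LSeries a (2 + t * I)‖) := by rw [h1, mul_one]
    _ ≤ ‖(2 + t * I : ℂ) - 1‖ * (‖riemannZeta (2 + t * I)‖ * (1 + B)) := by
        gcongr; linarith
    _ = _ := by ring

lemma riemannZeta₁_ne_zero_of_RH (hRH : RiemannHypothesis) {s : ℂ} (hs : 1 / 2 < s.re) :
    riemannZeta₁ s ≠ 0 := by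
  rcases eq_or_ne s 1 with rfl | h1
  · simp
  · intro h0
    have hz : riemannZeta s = 0 := by rw [riemannZeta_eq_inv_sub_mul h1, h0, mul_zero]
    have := hRH s hz (by
      rintro ⟨n, hn⟩
      rw [hn] at hs
      simp at hs
      have : (0 : ℝ) ≤ n := n.cast_nonneg
      linarith) h1
    linarith

lemma exists_inv_riemannZeta₁_bound (hRH : RiemannHypothesis) {η : ℝ} (hη : 0 < η) (hη' : η < 1) :
    ∃ C : ℝ, 0 < C ∧ ∃ K : ℕ, ∀ s : ℂ, 1 / 2 + η ≤ s.re → s.re ≤ 2 →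
      ‖(riemannZeta₁ s)⁻¹‖ ≤ C * (1 + |s.im|) ^ K := by
  obtain ⟨c, hc, hc1, hcle⟩ := exists_le_norm_riemannZeta₁_two_add
  obtain ⟨K, hK⟩ := exists_nat_ge (2 * (3 / 2 - η) / ((3 / 2 - η / 2) - (3 / 2 - η)))
  refine ⟨(75 / c) ^ K / c, by positivity, 2 * K, fun s hs1 hs2 => ?_⟩
  set t := s.im with ht
  have hball : ∀ w ∈ Metric.ball (2 + t * I : ℂ) (3 / 2 - η / 2),
      1 / 2 < w.re ∧ ‖w‖ ≤ 4 + |t| := by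
    intro w hw
    rw [mem_ball_iff_norm] at hw
    have h1 := (Complex.abs_re_le_norm (w - (2 + t * I))).trans_lt hw
    have h2 : (w - (2 + t * I)).re = w.re - 2 := by simp
    rw [h2, abs_lt] at h1
    refine ⟨by linarith, ?_⟩
    have h3 : ‖(2 + t * I : ℂ)‖ ≤ 2 + |t| := (norm_add_le _ _).trans (by simp)
    have h4 : ‖w‖ ≤ ‖w - (2 + t * I)‖ + ‖(2 + t * I : ℂ)‖ := by
      simpa using norm_add_le (w - (2 + t * I)) (2 + t * I)
    linarith
  have habs : 0 ≤ |t| := abs_nonneg t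
  have key := norm_center_le_of_ne_zero_on_ball (f := riemannZeta₁) (s₀ := 2 + t * I) (z := s)
    (R := 3 / 2 - η / 2) (r := 3 / 2 - η) (A := 75 * (1 + |t|) ^ 2) (c := c) (K := K)
    differentiable_riemannZeta₁ (by linarith)
    (fun w hw => riemannZeta₁_ne_zero_of_RH hRH (hball w hw).1)
    (fun w hw => by
      obtain ⟨h1, h2⟩ := hball w hw
      refine (norm_riemannZeta₁_le h1.le).trans ?_
      have : 1 + ‖w‖ ≤ 5 * (1 + |t|) := by linarith
      calc 3 * (1 + ‖w‖) ^ 2 ≤ 3 * (5 * (1 + |t|)) ^ 2 := by gcongr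
        _ = _ := by ring)
    hc (by nlinarith) (hcle t) (by linarith) (by
      have : s - (2 + t * I) = ((s.re - 2 : ℝ) : ℂ) := by
        apply Complex.ext <;> simp [ht]
      rw [this, Complex.norm_real, Real.norm_eq_abs, abs_le]
      constructor <;> linarith) hK
  have hne := riemannZeta₁_ne_zero_of_RH hRH (s := s) (by linarith)
  rw [norm_inv, inv_le_iff_one_le_mul₀ (norm_pos_iff.mpr hne)]
  have h5 : (75 / c) ^ K / c * (1 + |t|) ^ (2 * K) = (75 * (1 + |t|) ^ 2 / c) ^ K / c := by
    rw [pow_mul, div_mul_eq_mul_div, ← mul_pow]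
    congr 2
    ring
  rw [h5, div_mul_eq_mul_div, one_le_div hc]
  exact key

/-- A smooth function supported in the compact interval `[a, b]` of positive reals. -/
structure IsBump (a b : ℝ) (V : ℝ → ℝ) : Prop where
  pos : 0 < a
  one_le : 1 ≤ b
  smooth : ContDiff ℝ (⊤ : ℕ∞) V
  supp : ∀ t, t ∉ Set.Icc a b → V t = 0

namespace IsBump

variable {a b : ℝ} {V : ℝ → ℝ}

lemma continuous (h : IsBump a b V) : Continuous V := h.smooth.continuous

lemma differentiable (h : IsBump a b V) : Differentiable ℝ V :=
  h.smooth.differentiable (by simp)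

lemma deriv' (h : IsBump a b V) : IsBump a b (deriv V) where
  pos := h.pos
  one_le := h.one_le
  smooth := h.smooth.iterate_deriv 1
  supp t ht := by
    have h1 : V =ᶠ[nhds t] fun _ => 0 := by
      filter_upwards [isClosed_Icc.isOpen_compl.mem_nhds ht] with u hu
      exact h.supp u hu
    rw [h1.deriv_eq]
    simp

lemma mul_left (h : IsBump a b V) {f : ℝ → ℝ} (hf : ContDiff ℝ (⊤ : ℕ∞) f) :
    IsBump a b (fun t => f t * V t) where
  pos := h.pos
  one_le := h.one_le
  smooth := hf.mul h.smooth
  supp t ht := by simp [h.supp t ht]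

/-- The Euler derivative `t ↦ t * deriv V t` of a bump function is a bump function. -/
lemma euler (h : IsBump a b V) : IsBump a b (fun t => t * deriv V t) :=
  h.deriv'.mul_left contDiff_id

lemma hasCompactSupport (h : IsBump a b V) : HasCompactSupport V :=
  HasCompactSupport.of_support_subset_isCompact (isCompact_Icc (a := a) (b := b))
    fun t ht => by by_contra hc; exact ht (h.supp t hc)

lemma integrable (h : IsBump a b V) : MeasureTheory.Integrable V :=
  h.continuous.integrable_of_hasCompactSupport h.hasCompactSupport

lemma exists_bound (h : IsBump a b V) : ∃ M, 0 ≤ M ∧ ∀ t, |V t| ≤ M := by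
  obtain ⟨M, hM⟩ := h.hasCompactSupport.exists_bound_of_continuous h.continuous
  exact ⟨M, (norm_nonneg _).trans (hM 0), hM⟩

lemma eq_zero_of_le (h : IsBump a b V) {t : ℝ} (ht : t ≤ 0) : V t = 0 :=
  h.supp t fun hc => absurd hc.1 (by linarith [h.pos])

lemma eq_zero_of_lt (h : IsBump a b V) {t : ℝ} (ht : b < t) : V t = 0 :=
  h.supp t fun hc => absurd hc.2 (by linarith)

lemma mul_natCast_eq_zero (h : IsBump a b V) {x : ℝ} (hx : 0 < x) {N : ℕ} (hN : b / x < N)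
    {m : ℕ} (hm : N ≤ m) : V (m * x) = 0 := by
  refine h.eq_zero_of_lt ?_
  rw [div_lt_iff₀ hx] at hN
  have : (N : ℝ) ≤ m := by exact_mod_cast hm
  nlinarith

/-- The trapezoidal rule: Riemann sums of bump functions converge with a quadratic error. -/
lemma exists_riemann_sum_bound (h : IsBump a b V) :
    ∃ C, 0 ≤ C ∧ ∀ x, 0 < x → x ≤ b →
      |x * ∑' m : ℕ, V (m * x) - ∫ t, V t| ≤ C * x ^ 2 := by
  obtain ⟨M, hM0, hM⟩ := h.deriv'.deriv'.exists_bound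
  have hb : 0 < b := by linarith [h.one_le]
  refine ⟨2 * b * M / 12, by positivity, fun x hx hxb => ?_⟩
  set N : ℕ := ⌊b / x⌋₊ + 1 with hN
  have hNb : b / x < N := by rw [hN]; push_cast; exact Nat.lt_floor_add_one _
  have hNx : b < N * x := by rwa [div_lt_iff₀ hx] at hNb
  have hNx' : (N : ℝ) * x ≤ 2 * b := by
    have h1 : (⌊b / x⌋₊ : ℝ) ≤ b / x := Nat.floor_le (by positivity)
    rw [le_div_iff₀ hx] at h1
    rw [hN]; push_cast; linarith
  have hN0 : 0 < N := by omega
  have hNr : (N : ℝ) ≠ 0 := by positivity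
  have hle : (0 : ℝ) ≤ N * x := by positivity
  have hlt : (0 : ℝ) < N * x := by linarith
  have hζ : ∀ t, |iteratedDerivWithin 2 V (Set.uIcc 0 (N * x)) t| ≤ M := by
    intro t
    rw [Set.uIcc_of_le hle]
    by_cases ht : t ∈ Set.Icc (0 : ℝ) (N * x)
    · rw [iteratedDerivWithin_eq_iteratedDeriv (uniqueDiffOn_Icc hlt)
        (h.smooth.of_le (WithTop.coe_le_coe.mpr (le_top (a := (2 : ℕ∞))))).contDiffAt ht, iteratedDeriv_succ,
        iteratedDeriv_one]
      exact hM t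
    · rw [iteratedDerivWithin_succ, derivWithin_zero_of_notMem_closure]
      · simpa using hM0
      · rwa [isClosed_Icc.closure_eq]
  have herr := trapezoidal_error_le_of_c2 (f := V) (a := 0) (b := N * x)
    ((h.smooth.of_le (WithTop.coe_le_coe.mpr (le_top (a := (2 : ℕ∞))))).contDiffOn) hζ hN0
  have hsum : ∑' m : ℕ, V (m * x) = ∑ k ∈ Finset.range (N - 1), V (0 + (k + 1) * (N * x - 0) / N) := by
    rw [tsum_eq_sum (s := Finset.range N)]
    · obtain ⟨n, hn⟩ : ∃ n, N = n + 1 := ⟨_, hN⟩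
      rw [hn, Finset.sum_range_succ']
      simp only [Nat.cast_zero, zero_mul, h.eq_zero_of_le le_rfl, add_zero, Nat.add_sub_cancel]
      refine Finset.sum_congr rfl fun k _ => ?_
      congr 1
      rw [hn] at hNr
      push_cast at hNr ⊢
      field_simp
      ring
    · intro m hm
      exact h.mul_natCast_eq_zero hx hNb (by simpa using hm)
  have hint : ∫ t in (0 : ℝ)..(N * x), V t = ∫ t, V t := by
    refine intervalIntegral.integral_eq_integral_of_support_subset fun t ht => ?_
    by_contra hc
    refine ht (h.supp t fun h2 => hc ⟨by linarith [h2.1, h.pos], h2.2.trans hNx.le⟩)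
  rw [trapezoidal_error, trapezoidal_integral, ← hsum, hint, h.eq_zero_of_le le_rfl,
    h.eq_zero_of_lt hNx] at herr
  have e1 : (N * x - 0) / N * ((0 + 0) / 2 + ∑' m : ℕ, V (m * x)) = x * ∑' m : ℕ, V (m * x) := by
    field_simp
    ring
  rw [e1] at herr
  refine herr.trans ?_
  rw [sub_zero, abs_of_pos hlt]
  have : (N * x) ^ 3 * M / (12 * N ^ 2) = (N * x) * M * x ^ 2 / 12 := by field_simp
  rw [this]
  calc (N * x) * M * x ^ 2 / 12 ≤ (2 * b) * M * x ^ 2 / 12 := by gcongr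
    _ = _ := by ring

end IsBump

/-- The error in approximating `∑ m V(m h)` by `h⁻² ∫ t V(t) dt`. -/
noncomputable def riemannRem (V : ℝ → ℝ) (h : ℝ) : ℝ :=
  ∑' m : ℕ, (m : ℝ) * V (m * h) - (∫ t, t * V t) / h ^ 2

namespace IsBump

variable {a b : ℝ} {V : ℝ → ℝ}

lemma exists_riemannRem_bound (h : IsBump a b V) :
    ∃ C, 0 ≤ C ∧ ∀ x, 0 < x → x ≤ b → |riemannRem V x| ≤ C := by
  obtain ⟨C, hC0, hC⟩ := (h.mul_left contDiff_id).exists_riemann_sum_bound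
  refine ⟨C, hC0, fun x hx hxb => ?_⟩
  have h1 := hC x hx hxb
  simp only [id] at h1
  have h2 : x * ∑' m : ℕ, (m : ℝ) * x * V (m * x) - ∫ t, t * V t = x ^ 2 * riemannRem V x := by
    rw [riemannRem, mul_sub, mul_div_cancel₀ _ (by positivity)]
    congr 1
    rw [← tsum_mul_left, ← tsum_mul_left]
    exact tsum_congr fun m => by ring
  rw [h2, abs_mul, abs_of_pos (by positivity : (0 : ℝ) < x ^ 2), mul_comm] at h1
  exact le_of_mul_le_mul_right h1 (by positivity)

lemma riemannRem_of_lt (h : IsBump a b V) {x : ℝ} (hx : b < x) :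
    riemannRem V x = - (∫ t, t * V t) / x ^ 2 := by
  have hb : 0 < b := by linarith [h.one_le]
  have hx0 : 0 < x := by linarith
  have : ∑' m : ℕ, (m : ℝ) * V (m * x) = 0 := by
    rw [← tsum_zero (α := ℝ) (β := ℕ)]
    refine tsum_congr fun m => ?_
    rcases Nat.eq_zero_or_pos m with rfl | hm
    · simp
    · rw [h.mul_natCast_eq_zero hx0 (N := 1) (by simpa using (div_lt_one hx0).mpr hx) hm, mul_zero]
  rw [riemannRem, this]
  ring

lemma integral_mul_euler (h : IsBump a b V) :
    ∫ t, t * (t * deriv V t) = -2 * ∫ t, t * V t := by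
  have hd : ∀ t, HasDerivAt (fun t => t ^ 2 * V t) (2 * (t * V t) + t * (t * deriv V t)) t := by
    intro t
    refine ((hasDerivAt_pow 2 t).mul (h.differentiable t).hasDerivAt).congr_deriv ?_
    norm_num
    ring
  have i1 : MeasureTheory.Integrable (fun t => 2 * (t * V t)) :=
    (h.mul_left contDiff_id).integrable.const_mul 2
  have i2 : MeasureTheory.Integrable (fun t => t * (t * deriv V t)) :=
    (h.euler.mul_left contDiff_id).integrable
  have i3 : MeasureTheory.Integrable (fun t => t ^ 2 * V t) :=
    (h.mul_left (contDiff_id.pow 2)).integrable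
  have := MeasureTheory.integral_eq_zero_of_hasDerivAt_of_integrable hd (i1.add i2) i3
  rw [MeasureTheory.integral_add i1 i2, MeasureTheory.integral_const_mul] at this
  linarith

lemma hasDerivAt_riemannRem (h : IsBump a b V) {x : ℝ} (hx : 0 < x) :
    HasDerivAt (riemannRem V) (riemannRem (fun t => t * deriv V t) x / x) x := by
  set N : ℕ := ⌊b / (x / 2)⌋₊ + 1 with hN
  have hx2 : 0 < x / 2 := by positivity
  have hb : 0 < b := by linarith [h.one_le]
  have hNb : ∀ y, x / 2 < y → b / y < N := by
    intro y hy
    have h1 : b / (x / 2) < N := by rw [hN]; push_cast; exact Nat.lt_floor_add_one _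
    refine lt_of_le_of_lt ?_ h1
    gcongr
  have hfin : ∀ {G : ℝ → ℝ}, IsBump a b G → ∀ y, x / 2 < y →
      ∑' m : ℕ, (m : ℝ) * G (m * y) = ∑ m ∈ Finset.range N, (m : ℝ) * G (m * y) := by
    intro G hG y hy
    refine tsum_eq_sum fun m hm => ?_
    rw [hG.mul_natCast_eq_zero (hx2.trans hy) (hNb y hy) (by simpa using hm), mul_zero]
  have hev : riemannRem V =ᶠ[nhds x] fun y =>
      ∑ m ∈ Finset.range N, (m : ℝ) * V (m * y) - (∫ t, t * V t) * (y ^ 2)⁻¹ := by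
    filter_upwards [Ioi_mem_nhds (by linarith : x / 2 < x)] with y hy
    rw [riemannRem, hfin h y hy, div_eq_mul_inv]
  refine HasDerivAt.congr_of_eventuallyEq ?_ hev
  have hsum : HasDerivAt (fun y => ∑ m ∈ Finset.range N, (m : ℝ) * V (m * y))
      (∑ m ∈ Finset.range N, (m : ℝ) * (deriv V (m * x) * m)) x := by
    refine HasDerivAt.fun_sum fun m _ => ?_
    refine HasDerivAt.const_mul _ ?_
    have h1 : HasDerivAt (fun y : ℝ => (m : ℝ) * y) m x := by
      simpa using (hasDerivAt_id x).const_mul (m : ℝ)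
    exact (h.differentiable _).hasDerivAt.comp x h1
  have hpow : HasDerivAt (fun y : ℝ => (∫ t, t * V t) * (y ^ 2)⁻¹)
      ((∫ t, t * V t) * (-(2 * x) / (x ^ 2) ^ 2)) x := by
    refine HasDerivAt.const_mul _ ?_
    have := (hasDerivAt_pow 2 x).fun_inv (by positivity)
    simpa using this
  refine (hsum.sub hpow).congr_deriv ?_
  rw [riemannRem, hfin h.euler x (by linarith), h.integral_mul_euler, sub_div, Finset.sum_div]
  congr 1
  · refine Finset.sum_congr rfl fun m _ => ?_
    field_simp
  · field_simp

end IsBump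

/-- A sequence of functions on `(0, ∞)`, each the Euler derivative of its predecessor, all bounded
and decaying quadratically at infinity. -/
structure IsEulerSeq (f : ℕ → ℝ → ℝ) : Prop where
  hasDerivAt : ∀ k t, 0 < t → HasDerivAt (f k) (f (k + 1) t / t) t
  bound : ∀ k, ∃ C, 0 ≤ C ∧ ∀ t, 0 < t → |f k t| ≤ C ∧ t ^ 2 * |f k t| ≤ C

namespace IsEulerSeq

variable {f : ℕ → ℝ → ℝ}

lemma continuousOn (h : IsEulerSeq f) (k : ℕ) :
    ContinuousOn (fun t => (f k t : ℂ)) (Set.Ioi 0) := fun t ht =>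
  ((continuous_ofReal.continuousAt).comp (h.hasDerivAt k t ht).continuousAt).continuousWithinAt

lemma isBigO_atTop (h : IsEulerSeq f) (k : ℕ) :
    (fun t => (f k t : ℂ)) =O[atTop] fun t : ℝ => t ^ (-(2 : ℝ)) := by
  obtain ⟨C, hC0, hC⟩ := h.bound k
  refine Asymptotics.IsBigO.of_bound C ?_
  filter_upwards [eventually_gt_atTop 0] with t ht
  have h1 := (hC t ht).2
  rw [Complex.norm_real, Real.norm_eq_abs, Real.norm_of_nonneg (by positivity),
    Real.rpow_neg ht.le, ← div_eq_mul_inv, le_div_iff₀ (by positivity), mul_comm]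
  exact_mod_cast h1

lemma isBigO_zero (h : IsEulerSeq f) (k : ℕ) :
    (fun t => (f k t : ℂ)) =O[nhdsWithin 0 (Set.Ioi 0)] fun t : ℝ => t ^ (-(0 : ℝ)) := by
  obtain ⟨C, hC0, hC⟩ := h.bound k
  refine Asymptotics.IsBigO.of_bound C ?_
  filter_upwards [self_mem_nhdsWithin] with t ht
  simpa using (hC t ht).1

lemma mellinConvergent (h : IsEulerSeq f) (k : ℕ) {s : ℂ} (hs : 0 < s.re) (hs' : s.re < 2) :
    MellinConvergent (fun t => (f k t : ℂ)) s :=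
  mellinConvergent_of_isBigO_rpow
    ((h.continuousOn k).locallyIntegrableOn measurableSet_Ioi)
    (h.isBigO_atTop k) hs' (h.isBigO_zero k) hs

lemma differentiableAt_mellin (h : IsEulerSeq f) (k : ℕ) {s : ℂ} (hs : 0 < s.re) (hs' : s.re < 2) :
    DifferentiableAt ℂ (mellin fun t => (f k t : ℂ)) s :=
  mellin_differentiableAt_of_isBigO_rpow
    ((h.continuousOn k).locallyIntegrableOn measurableSet_Ioi)
    (h.isBigO_atTop k) hs' (h.isBigO_zero k) hs

lemma mul_mellin (h : IsEulerSeq f) (k : ℕ) {s : ℂ} (hs : 0 < s.re) (hs' : s.re < 2) :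
    s * mellin (fun t => (f k t : ℂ)) s = -mellin (fun t => (f (k + 1) t : ℂ)) s := by
  have hs0 : s ≠ 0 := by rintro rfl; simp at hs
  obtain ⟨C, hC0, hC⟩ := h.bound k
  have hderiv : ∀ t ∈ Set.Ioi (0 : ℝ), HasDerivAt (fun t : ℝ => (t : ℂ) ^ s * (f k t : ℂ))
      (s * ((t : ℂ) ^ (s - 1) • (f k t : ℂ)) + (t : ℂ) ^ (s - 1) • (f (k + 1) t : ℂ)) t := by
    intro t ht
    have ht0 : (t : ℂ) ≠ 0 := by exact_mod_cast ht.ne'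
    have h1 : HasDerivAt (fun t : ℝ => (t : ℂ) ^ s) (s * (t : ℂ) ^ (s - 1)) t := by
      have := (hasDerivAt_id' (t : ℂ)).cpow_const (c := s) (Or.inl (by simpa using ht))
      simpa using this.comp_ofReal
    refine (h1.mul (h.hasDerivAt k t ht).ofReal_comp).congr_deriv ?_
    rw [cpow_sub _ _ ht0, cpow_one, smul_eq_mul, smul_eq_mul]
    push_cast
    field_simp
  have i1 := (h.mellinConvergent k hs hs').const_mul s
  have i2 := h.mellinConvergent (k + 1) hs hs'
  have htop : Tendsto (fun t : ℝ => (t : ℂ) ^ s * (f k t : ℂ)) atTop (nhds 0) := by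
    have h0 : Tendsto (fun t : ℝ => C * t ^ (-(2 - s.re))) atTop (nhds 0) := by
      simpa using (tendsto_rpow_neg_atTop (by linarith : 0 < 2 - s.re)).const_mul C
    refine squeeze_zero_norm' ?_ h0
    filter_upwards [eventually_gt_atTop 0] with t ht
    rw [norm_mul, norm_cpow_eq_rpow_re_of_pos ht, Complex.norm_real, Real.norm_eq_abs, neg_sub,
      Real.rpow_sub ht, Real.rpow_two, mul_div_assoc', le_div_iff₀ (by positivity)]
    have := (hC t ht).2
    have h3 : 0 < t ^ s.re := by positivity
    nlinarith
  have hzero : ContinuousWithinAt (fun t : ℝ => (t : ℂ) ^ s * (f k t : ℂ)) (Set.Ici 0) 0 := by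
    rw [← continuousWithinAt_Ioi_iff_Ici]
    rw [ContinuousWithinAt]
    simp only [ofReal_zero, zero_cpow hs0, zero_mul]
    have h0 : Tendsto (fun t : ℝ => C * t ^ s.re) (nhdsWithin 0 (Set.Ioi 0)) (nhds 0) := by
      have := (Real.continuousAt_rpow_const 0 s.re (Or.inr hs.le)).tendsto
      rw [Real.zero_rpow hs.ne'] at this
      simpa using (this.mono_left nhdsWithin_le_nhds).const_mul C
    refine squeeze_zero_norm' ?_ h0
    filter_upwards [self_mem_nhdsWithin] with t ht
    rw [norm_mul, norm_cpow_eq_rpow_re_of_pos ht, Complex.norm_real, Real.norm_eq_abs, mul_comm]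
    have h3 : 0 < t ^ s.re := Real.rpow_pos_of_pos ht _
    exact mul_le_mul_of_nonneg_right (hC t ht).1 h3.le
  have := MeasureTheory.integral_Ioi_of_hasDerivAt_of_tendsto hzero hderiv (i1.add i2) htop
  rw [MeasureTheory.integral_add i1 i2, MeasureTheory.integral_const_mul] at this
  simp only [ofReal_zero, zero_cpow hs0, zero_mul, sub_zero] at this
  exact eq_neg_of_add_eq_zero_left this

lemma exists_mellin_bound (h : IsEulerSeq f) (k : ℕ) {σ₀ σ₁ : ℝ} (h0 : 0 < σ₀) (h01 : σ₀ ≤ σ₁)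
    (h1 : σ₁ < 2) : ∃ C, 0 ≤ C ∧ ∀ s : ℂ, σ₀ ≤ s.re → s.re ≤ σ₁ →
      ‖mellin (fun t => (f k t : ℂ)) s‖ ≤ C := by
  have i0 := (h.mellinConvergent k (s := σ₀) (by simpa) (by simp; linarith)).norm
  have i1 := (h.mellinConvergent k (s := σ₁) (by simp; linarith) (by simpa)).norm
  refine ⟨_, ?_, fun s hs0 hs1 =>
    MeasureTheory.norm_integral_le_of_norm_le (i0.add i1) ?_⟩
  · exact MeasureTheory.integral_nonneg fun t => by simp only [Pi.add_apply]; positivity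
  · refine (MeasureTheory.ae_restrict_iff' measurableSet_Ioi).mpr (Eventually.of_forall ?_)
    intro t ht
    simp only [Pi.add_apply, norm_smul]
    rw [← add_mul]
    refine mul_le_mul_of_nonneg_right ?_ (norm_nonneg _)
    have ht' : 0 < t := ht
    rw [norm_cpow_eq_rpow_re_of_pos ht, norm_cpow_eq_rpow_re_of_pos ht,
      norm_cpow_eq_rpow_re_of_pos ht]
    simp only [sub_re, ofReal_re, one_re]
    rcases le_total t 1 with h2 | h2
    · have := Real.rpow_le_rpow_of_exponent_ge ht' h2 (by linarith : σ₀ - 1 ≤ s.re - 1)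
      have := Real.rpow_pos_of_pos ht' (σ₁ - 1)
      linarith
    · have := Real.rpow_le_rpow_of_exponent_le h2 (by linarith : s.re - 1 ≤ σ₁ - 1)
      have := Real.rpow_pos_of_pos ht' (σ₀ - 1)
      linarith

lemma norm_mellin (h : IsEulerSeq f) (j : ℕ) {s : ℂ} (hs : 0 < s.re) (hs' : s.re < 2) :
    ‖s‖ ^ j * ‖mellin (fun t => (f 0 t : ℂ)) s‖ = ‖mellin (fun t => (f j t : ℂ)) s‖ := by
  induction j with
  | zero => simp
  | succ j ih =>
    rw [pow_succ, mul_comm _ ‖s‖, mul_assoc, ih, ← norm_mul, h.mul_mellin j hs hs', norm_neg]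

/-- The Mellin transform decays faster than any polynomial in vertical strips. -/
lemma exists_mellin_decay (h : IsEulerSeq f) (k : ℕ) {σ₀ σ₁ : ℝ} (h0 : 0 < σ₀) (h01 : σ₀ ≤ σ₁)
    (h1 : σ₁ < 2) : ∃ C, 0 ≤ C ∧ ∀ s : ℂ, σ₀ ≤ s.re → s.re ≤ σ₁ →
      (1 + |s.im|) ^ k * ‖mellin (fun t => (f 0 t : ℂ)) s‖ ≤ C := by
  obtain ⟨C, hC0, hC⟩ := h.exists_mellin_bound k h0 h01 h1
  refine ⟨(1 / σ₀ + 1) ^ k * C, by positivity, fun s hs0 hs1 => ?_⟩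
  have h2 : 1 + |s.im| ≤ (1 / σ₀ + 1) * ‖s‖ := by
    have h3 : 1 ≤ 1 / σ₀ * ‖s‖ := by
      rw [one_div, inv_mul_eq_div, le_div_iff₀ h0, one_mul]
      exact hs0.trans (re_le_norm s)
    have := abs_im_le_norm s
    linarith
  calc (1 + |s.im|) ^ k * ‖mellin (fun t => (f 0 t : ℂ)) s‖
      ≤ ((1 / σ₀ + 1) * ‖s‖) ^ k * ‖mellin (fun t => (f 0 t : ℂ)) s‖ := by gcongr
    _ = (1 / σ₀ + 1) ^ k * ‖mellin (fun t => (f k t : ℂ)) s‖ := by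
      rw [mul_pow, mul_assoc, h.norm_mellin k (by linarith) (by linarith)]
    _ ≤ _ := by gcongr; exact hC s hs0 hs1

end IsEulerSeq

lemma integrable_inv_one_add_abs_sq :
    MeasureTheory.Integrable fun t : ℝ => ((1 + |t|) ^ 2)⁻¹ := by
  refine integrable_inv_one_add_sq.mono' (by fun_prop) (Eventually.of_forall fun t => ?_)
  rw [Real.norm_of_nonneg (by positivity)]
  have : 1 + t ^ 2 ≤ (1 + |t|) ^ 2 := by
    have := abs_nonneg t
    nlinarith [sq_abs t]
  gcongr

/-- A function with quadratic decay on a vertical line is integrable there. -/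
lemma integrable_vertical {G : ℂ → ℂ} {σ C : ℝ}
    (hG : ∀ s : ℂ, s.re = σ → DifferentiableAt ℂ G s)
    (hb : ∀ s : ℂ, s.re = σ → (1 + |s.im|) ^ 2 * ‖G s‖ ≤ C) :
    MeasureTheory.Integrable fun t : ℝ => G (σ + t * I) := by
  have hc : Continuous fun t : ℝ => G (σ + t * I) := by
    refine continuous_iff_continuousAt.mpr fun t => ?_
    have h1 : ContinuousAt G (σ + t * I) := (hG _ (by simp)).continuousAt
    exact h1.comp (f := fun t : ℝ => (σ + t * I : ℂ)) (by fun_prop)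
  refine (integrable_inv_one_add_abs_sq.const_mul C).mono' hc.aestronglyMeasurable
    (Eventually.of_forall fun t => ?_)
  have := hb (σ + t * I) (by simp)
  rw [← div_eq_mul_inv, le_div_iff₀ (by positivity), mul_comm]
  simpa using this

/-- Shifting the line of integration of a holomorphic function with quadratic decay. -/
lemma integral_vertical_eq {G : ℂ → ℂ} {σ₀ σ₁ C : ℝ} (h01 : σ₀ ≤ σ₁)
    (hG : ∀ s : ℂ, σ₀ ≤ s.re → s.re ≤ σ₁ → DifferentiableAt ℂ G s)
    (hb : ∀ s : ℂ, σ₀ ≤ s.re → s.re ≤ σ₁ → (1 + |s.im|) ^ 2 * ‖G s‖ ≤ C) :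
    ∫ t : ℝ, G (σ₀ + t * I) = ∫ t : ℝ, G (σ₁ + t * I) := by
  have i0 := integrable_vertical (σ := σ₀) (fun s hs => hG s hs.ge (hs.le.trans h01))
    (fun s hs => hb s hs.ge (hs.le.trans h01))
  have i1 := integrable_vertical (σ := σ₁) (fun s hs => hG s (h01.trans hs.ge) hs.le)
    (fun s hs => hb s (h01.trans hs.ge) hs.le)
  have hlim : ∀ {σ : ℝ}, MeasureTheory.Integrable (fun t : ℝ => G (σ + t * I)) →
      Tendsto (fun T : ℝ => ∫ t in (-T)..T, G (σ + t * I)) atTop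
        (nhds (∫ t : ℝ, G (σ + t * I))) := fun hi =>
    MeasureTheory.intervalIntegral_tendsto_integral hi tendsto_neg_atTop_atBot tendsto_id
  have hC0 : 0 ≤ C := le_trans (by positivity) (hb σ₀ (by simp) (by simpa))
  have hdiff : Tendsto (fun T : ℝ => (∫ t in (-T)..T, G (σ₁ + t * I)) -
      ∫ t in (-T)..T, G (σ₀ + t * I)) atTop (nhds 0) := by
    have h0 : Tendsto (fun T : ℝ => 2 * (C * (σ₁ - σ₀)) / T) atTop (nhds 0) :=
      tendsto_const_nhds.div_atTop tendsto_id
    refine squeeze_zero_norm' ?_ h0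
    filter_upwards [eventually_ge_atTop 1] with T hT
    have hrect := integral_boundary_rect_eq_zero_of_differentiableOn G
      ⟨σ₀, -T⟩ ⟨σ₁, T⟩ (by
        intro s hs
        have h1 := hs.1
        simp only [Set.mem_preimage, Set.uIcc_of_le h01, Set.mem_Icc] at h1
        exact (hG s h1.1 h1.2).differentiableWithinAt)
    simp only [smul_eq_mul] at hrect
    have hside : ∀ τ : ℝ, |τ| = T → ‖∫ x in σ₀..σ₁, G (x + τ * I)‖ ≤ C * (σ₁ - σ₀) / T := by
      intro τ hτ
      have : ‖∫ x in σ₀..σ₁, G (x + τ * I)‖ ≤ C / T * |σ₁ - σ₀| := by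
        refine intervalIntegral.norm_integral_le_of_norm_le_const fun x hx => ?_
        rw [Set.uIoc_of_le h01] at hx
        have h2 := hb (x + τ * I) (by simpa using hx.1.le) (by simpa using hx.2)
        simp only [add_im, ofReal_im, mul_im, ofReal_re, I_im, mul_one, I_re, mul_zero, add_zero,
          zero_add, hτ] at h2
        rw [le_div_iff₀ (by linarith)]
        have h3 : T ≤ (1 + T) ^ 2 := by nlinarith
        nlinarith [norm_nonneg (G (x + τ * I))]
      rw [abs_of_nonneg (by linarith)] at this
      linarith [this, (by ring : C / T * (σ₁ - σ₀) = C * (σ₁ - σ₀) / T)]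
    have e1 := hside T (abs_of_pos (by linarith))
    have e2 := hside (-T) (by rw [abs_neg]; exact abs_of_pos (by linarith))
    have e3 : I * ((∫ t in (-T)..T, G (σ₁ + t * I)) - ∫ t in (-T)..T, G (σ₀ + t * I)) =
        (∫ x in σ₀..σ₁, G (x + T * I)) - ∫ x in σ₀..σ₁, G (x + (-T : ℝ) * I) := by
      linear_combination hrect
    have e4 := congrArg norm e3
    rw [norm_mul, norm_I, one_mul] at e4
    rw [e4]
    refine (norm_sub_le _ _).trans ?_
    linarith [e1, e2, (by ring : 2 * (C * (σ₁ - σ₀)) / T = C * (σ₁ - σ₀) / T + C * (σ₁ - σ₀) / T)]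
  have := tendsto_nhds_unique hdiff ((hlim i1).sub (hlim i0))
  exact (sub_eq_zero.mp this.symm).symm

/-- The Euler operator `V ↦ t * deriv V t`. -/
noncomputable def eulerOp (V : ℝ → ℝ) : ℝ → ℝ := fun t => t * deriv V t

namespace IsBump

variable {a b : ℝ} {V : ℝ → ℝ}

lemma iterate_eulerOp (h : IsBump a b V) (k : ℕ) : IsBump a b (eulerOp^[k] V) := by
  induction k with
  | zero => exact h
  | succ k ih => rw [Function.iterate_succ_apply']; exact ih.euler

lemma isEulerSeq (h : IsBump a b V) : IsEulerSeq fun k => eulerOp^[k] V where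
  hasDerivAt k t ht := by
    rw [Function.iterate_succ_apply', eulerOp, mul_div_cancel_left₀ _ ht.ne']
    exact ((h.iterate_eulerOp k).differentiable t).hasDerivAt
  bound k := by
    obtain ⟨M, hM0, hM⟩ := (h.iterate_eulerOp k).exists_bound
    have hb := h.one_le
    refine ⟨b ^ 2 * M, by positivity, fun t ht => ⟨?_, ?_⟩⟩
    · refine (hM t).trans (le_mul_of_one_le_left hM0 (one_le_pow₀ hb))
    · rcases le_or_gt t b with htb | htb
      · gcongr
        exact hM t
      · rw [(h.iterate_eulerOp k).eq_zero_of_lt htb]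
        simp
        positivity

lemma isEulerSeq_riemannRem (h : IsBump a b V) :
    IsEulerSeq fun k => riemannRem (eulerOp^[k] V) where
  hasDerivAt k t ht := by
    rw [Function.iterate_succ_apply']
    exact (h.iterate_eulerOp k).hasDerivAt_riemannRem ht
  bound k := by
    obtain ⟨M, hM0, hM⟩ := (h.iterate_eulerOp k).exists_riemannRem_bound
    have hb := h.one_le
    set A := |∫ t, t * (eulerOp^[k] V) t| with hA
    have hA0 : 0 ≤ A := abs_nonneg _
    have hb2 : 1 ≤ b ^ 2 := one_le_pow₀ hb
    refine ⟨b ^ 2 * M + A, by positivity, fun t ht => ?_⟩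
    rcases le_or_gt t b with htb | htb
    · have := hM t ht htb
      refine ⟨by nlinarith, ?_⟩
      have h1 : t ^ 2 * |riemannRem (eulerOp^[k] V) t| ≤ b ^ 2 * M := by gcongr
      linarith
    · rw [(h.iterate_eulerOp k).riemannRem_of_lt htb, abs_div, abs_neg, ← hA,
        abs_of_pos (by positivity : 0 < t ^ 2), mul_div_cancel₀ _ (by positivity)]
      have h1 : A / t ^ 2 ≤ A := div_le_self hA0 (one_le_pow₀ (hb.trans htb.le))
      have : 0 ≤ b ^ 2 * M := by positivity
      exact ⟨by linarith, by linarith⟩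

lemma div_eq_zero (h : IsBump a b V) {x : ℝ} (hx : 0 < x) {q : ℕ} (hq : ⌊b * x⌋₊ < q) :
    V (q / x) = 0 :=
  h.eq_zero_of_lt (by rw [lt_div_iff₀ hx]; exact (Nat.floor_lt' (by omega)).mp hq)

end IsBump

lemma totient_eq_sum_moebius {q : ℕ} (hq : 0 < q) :
    ∑ p ∈ q.divisorsAntidiagonal, ((ArithmeticFunction.moebius p.1 : ℤ) : ℂ) * (p.2 : ℂ) =
      (Nat.totient q : ℂ) :=
  (ArithmeticFunction.sum_eq_iff_sum_mul_moebius_eq (R := ℂ) (f := fun n => (Nat.totient n : ℂ))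
    (g := fun n => (n : ℂ))).mp
    (fun n _ => by exact_mod_cast Nat.sum_totient n) q hq

/-- A finitely supported sum weighted by Euler's totient, in terms of the Möbius function. -/
lemma sum_totient_mul {G : ℕ → ℂ} {N : ℕ} (hG : ∀ n, N < n → G n = 0) :
    ∑ q ∈ Finset.Ioc 0 N, (Nat.totient q : ℂ) * G q =
      ∑ d ∈ Finset.Ioc 0 N, ((ArithmeticFunction.moebius d : ℤ) : ℂ) *
        ∑ m ∈ Finset.Ioc 0 N, (m : ℂ) * G (d * m) := by
  have h1 : ∀ q ∈ Finset.Ioc 0 N, (Nat.totient q : ℂ) * G q =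
      ∑ p ∈ Finset.Ioc 0 N ×ˢ Finset.Ioc 0 N, if p.1 * p.2 = q then
        ((ArithmeticFunction.moebius p.1 : ℤ) : ℂ) * (p.2 : ℂ) * G (p.1 * p.2) else 0 := by
    intro q hq
    rw [Finset.mem_Ioc] at hq
    rw [← totient_eq_sum_moebius hq.1, Nat.divisorsAntidiagonal_eq_prod_filter_of_le hq.1.ne' hq.2,
      Finset.sum_mul, Finset.sum_filter]
    refine Finset.sum_congr rfl fun p _ => ?_
    split_ifs with h
    · rw [h]
    · rfl
  rw [Finset.sum_congr rfl h1, Finset.sum_comm, Finset.sum_product]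
  refine Finset.sum_congr rfl fun d hd => ?_
  rw [Finset.mul_sum]
  refine Finset.sum_congr rfl fun m hm => ?_
  rw [Finset.mem_Ioc] at hd hm
  rw [Finset.sum_ite_eq]
  split_ifs with h
  · ring
  · rw [hG (d * m) (by
      by_contra hc
      exact h (Finset.mem_Ioc.mpr ⟨Nat.mul_pos hd.1 hm.1, not_lt.mp hc⟩))]
    simp

lemma LSeries_moebius_eq {s : ℂ} (hs : 1 < s.re) :
    LSeries (fun n => ((ArithmeticFunction.moebius n : ℤ) : ℂ)) s =
      (s - 1) * (riemannZeta₁ s)⁻¹ := by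
  have h1 := LSeries_one_mul_Lseries_moebius hs
  rw [LSeries_one_eq_riemannZeta hs] at h1
  have hs1 : s ≠ 1 := by rintro rfl; simp at hs
  have h2 := eq_inv_of_mul_eq_one_right h1
  rw [h2, riemannZeta_eq_inv_sub_mul hs1, mul_inv, inv_inv]

lemma IsBump.tsum_totient_eq {a b : ℝ} {V : ℝ → ℝ} (h : IsBump a b V) {x : ℝ} (hx : 0 < x) :
    ∑' q : ℕ, (Nat.totient q : ℂ) * (V (q / x) : ℂ) =
      x ^ 2 / riemannZeta 2 * ((∫ t, t * V t : ℝ) : ℂ) +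
      ∑' d : ℕ, ((ArithmeticFunction.moebius d : ℤ) : ℂ) * (riemannRem V (d / x) : ℂ) := by
  set N := ⌊b * x⌋₊ with hN
  set A : ℝ := ∫ t, t * V t with hA
  have e1 : ∑' q : ℕ, (Nat.totient q : ℂ) * (V (q / x) : ℂ) =
      ∑ q ∈ Finset.Ioc 0 N, (Nat.totient q : ℂ) * (V (q / x) : ℂ) := by
    refine tsum_eq_sum fun q hq => ?_
    rcases Nat.eq_zero_or_pos q with rfl | hq0
    · simp
    · rw [h.div_eq_zero hx (by simp at hq; exact hq hq0)]
      simp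
  have e2 : ∑ q ∈ Finset.Ioc 0 N, (Nat.totient q : ℂ) * (V (q / x) : ℂ) =
      ∑ d ∈ Finset.Ioc 0 N, ((ArithmeticFunction.moebius d : ℤ) : ℂ) *
        ((∑' m : ℕ, (m : ℝ) * V (m * (d / x)) : ℝ) : ℂ) := by
    rw [sum_totient_mul (G := fun q => (V (q / x) : ℂ)) (N := N)
      fun n hn => by rw [h.div_eq_zero hx hn]; simp]
    refine Finset.sum_congr rfl fun d hd => ?_
    rw [Finset.mem_Ioc] at hd
    congr 1
    rw [tsum_eq_sum (s := Finset.Ioc 0 N)]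
    · push_cast
      refine Finset.sum_congr rfl fun m _ => ?_
      congr 3
      ring
    · intro m hm
      rcases Nat.eq_zero_or_pos m with rfl | hm0
      · simp
      · have hmN : N < m := by simp at hm; exact hm hm0
        have hmd : N < m * d := hmN.trans_le (Nat.le_mul_of_pos_right _ hd.1)
        have := h.div_eq_zero hx hmd
        rw [mul_div_assoc', ← Nat.cast_mul, this, mul_zero]
  have e3 : ∑ d ∈ Finset.Ioc 0 N, ((ArithmeticFunction.moebius d : ℤ) : ℂ) *
        ((∑' m : ℕ, (m : ℝ) * V (m * (d / x)) : ℝ) : ℂ) =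
      ∑' d : ℕ, ((ArithmeticFunction.moebius d : ℤ) : ℂ) *
        ((∑' m : ℕ, (m : ℝ) * V (m * (d / x)) : ℝ) : ℂ) := by
    refine (tsum_eq_sum fun d hd => ?_).symm
    rcases Nat.eq_zero_or_pos d with rfl | hd0
    · simp
    · have hdN : N < d := by simp at hd; exact hd hd0
      have : ∑' m : ℕ, (m : ℝ) * V (m * (d / x)) = 0 := by
        rw [← tsum_zero (α := ℝ) (β := ℕ)]
        refine tsum_congr fun m => ?_
        rcases Nat.eq_zero_or_pos m with rfl | hm
        · simp
        · have hmd : N < m * d := hdN.trans_le (Nat.le_mul_of_pos_left _ hm)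
          rw [mul_div_assoc', ← Nat.cast_mul, h.div_eq_zero hx hmd, mul_zero]
      rw [this]
      simp
  have e4 : ∀ d : ℕ, ((ArithmeticFunction.moebius d : ℤ) : ℂ) *
        ((∑' m : ℕ, (m : ℝ) * V (m * (d / x)) : ℝ) : ℂ) =
      x ^ 2 * A * LSeries.term (fun n => ((ArithmeticFunction.moebius n : ℤ) : ℂ)) 2 d +
      ((ArithmeticFunction.moebius d : ℤ) : ℂ) * (riemannRem V (d / x) : ℂ) := by
    intro d
    rcases Nat.eq_zero_or_pos d with rfl | hd
    · simp
    · have hd0 : (d : ℂ) ≠ 0 := by exact_mod_cast hd.ne'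
      have hx0 : (x : ℂ) ≠ 0 := by exact_mod_cast hx.ne'
      rw [LSeries.term_of_ne_zero hd.ne', riemannRem, ← hA]
      generalize ∑' m : ℕ, (m : ℝ) * V (m * (d / x)) = T
      push_cast
      rw [show (d : ℂ) ^ (2 : ℂ) = (d : ℂ) ^ 2 from by exact_mod_cast cpow_natCast (d : ℂ) 2]
      field_simp
      ring
  have s1 : Summable fun d : ℕ =>
      LSeries.term (fun n => ((ArithmeticFunction.moebius n : ℤ) : ℂ)) 2 d :=
    ArithmeticFunction.LSeriesSummable_moebius_iff.mpr (by simp)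
  have s2 : Summable fun d : ℕ =>
      ((ArithmeticFunction.moebius d : ℤ) : ℂ) * (riemannRem V (d / x) : ℂ) := by
    obtain ⟨C, hC0, hC⟩ := h.isEulerSeq_riemannRem.bound 0
    simp only [Function.iterate_zero, id] at hC
    refine Summable.of_norm_bounded (g := fun d : ℕ => C * x ^ 2 * (1 / (d : ℝ) ^ 2))
      ((Real.summable_one_div_nat_pow.mpr (by norm_num)).mul_left _) fun d => ?_
    rcases Nat.eq_zero_or_pos d with rfl | hd
    · simp
    · have hd0 : (0 : ℝ) < d := by exact_mod_cast hd
      have h1 := (hC (d / x) (by positivity)).2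
      have h2 : ‖((ArithmeticFunction.moebius d : ℤ) : ℂ)‖ ≤ 1 := by
        rw [Complex.norm_intCast]
        exact_mod_cast ArithmeticFunction.abs_moebius_le_one
      rw [norm_mul, Complex.norm_real, Real.norm_eq_abs]
      calc _ ≤ 1 * |riemannRem V (d / x)| := by gcongr
        _ = ((d / x) ^ 2 * |riemannRem V (d / x)|) * (x ^ 2 / d ^ 2) := by field_simp
        _ ≤ C * (x ^ 2 / d ^ 2) := by gcongr
        _ = _ := by ring
  rw [e1, e2, e3, tsum_congr e4, Summable.tsum_add (s1.mul_left _) s2, tsum_mul_left]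
  have h2 := LSeries_one_mul_Lseries_moebius (s := 2) (by simp)
  rw [LSeries_one_eq_riemannZeta (by simp)] at h2
  rw [show ∑' d : ℕ, LSeries.term (fun n => ((ArithmeticFunction.moebius n : ℤ) : ℂ)) 2 d =
    (riemannZeta 2)⁻¹ from eq_inv_of_mul_eq_one_right h2]
  ring

namespace IsBump

variable {a b : ℝ} {V : ℝ → ℝ}

/-- The Möbius-weighted sum of remainders as a vertical line integral. -/
lemma tsum_moebius_riemannRem (h : IsBump a b V) {x : ℝ} (hx : 0 < x) {σ : ℝ} (hσ : 1 < σ)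
    (hσ' : σ < 2) :
    ∑' d : ℕ, ((ArithmeticFunction.moebius d : ℤ) : ℂ) * (riemannRem V (d / x) : ℂ) =
      (1 / (2 * Real.pi) : ℝ) * ∫ t : ℝ, (fun s : ℂ => mellin (fun t => (riemannRem V t : ℂ)) s *
        (x : ℂ) ^ s * ((s - 1) * (riemannZeta₁ s)⁻¹)) (σ + t * I) := by
  have hE := h.isEulerSeq_riemannRem
  have hcv := hE.mellinConvergent 0 (s := σ) (by simp; linarith) (by simpa)
  have hda := fun t (ht : 0 < t) => hE.hasDerivAt 0 t ht
  obtain ⟨C, hC0, hC⟩ := hE.exists_mellin_decay 2 (σ₀ := σ) (σ₁ := σ) (by linarith) le_rfl hσ'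
  have hdf := fun (s : ℂ) (hs : s.re = σ) =>
    hE.differentiableAt_mellin 0 (s := s) (by linarith) (by linarith)
  simp only [Function.iterate_zero, id] at hcv hda hC hdf
  set R := mellin (fun t => (riemannRem V t : ℂ)) with hR
  have hint : MeasureTheory.Integrable fun t : ℝ => R (σ + t * I) :=
    integrable_vertical hdf fun s hs => hC s hs.ge hs.le
  set F : ℕ → ℝ → ℂ := fun d t => LSeries.term (fun n => ((ArithmeticFunction.moebius n : ℤ) : ℂ))
    (σ + t * I) d * ((x : ℂ) ^ (σ + t * I : ℂ) * R (σ + t * I)) with hF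
  have hx0 : (x : ℂ) ≠ 0 := by exact_mod_cast hx.ne'
  have hFnorm : ∀ d t, ‖F d t‖ = ‖((ArithmeticFunction.moebius d : ℤ) : ℂ)‖ *
      ((d : ℝ) ^ (-σ) * (x ^ σ * ‖R (σ + t * I)‖)) := by
    intro d t
    simp only [hF, norm_mul]
    rw [norm_cpow_eq_rpow_re_of_pos hx, LSeries.norm_term_eq]
    rcases Nat.eq_zero_or_pos d with rfl | hd
    · simp
    · rw [if_neg hd.ne', Real.rpow_neg (by positivity)]
      simp
      ring
  have hFint : ∀ d, MeasureTheory.Integrable (F d) := by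
    intro d
    have hmeas : MeasureTheory.AEStronglyMeasurable (F d) := by
      refine MeasureTheory.AEStronglyMeasurable.mul ?_ (.mul ?_ hint.1)
      · refine Continuous.aestronglyMeasurable ?_
        rcases Nat.eq_zero_or_pos d with rfl | hd
        · simpa using continuous_const
        · have hd0 : (d : ℂ) ≠ 0 := by exact_mod_cast hd.ne'
          simp only [LSeries.term_of_ne_zero hd.ne']
          refine continuous_const.div ?_ fun t => by simp [cpow_eq_zero_iff, hd0]
          exact Continuous.const_cpow (by fun_prop) (Or.inl hd0)
      · exact (Continuous.const_cpow (by fun_prop) (Or.inl hx0)).aestronglyMeasurable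
    refine (MeasureTheory.integrable_norm_iff hmeas).mp ?_
    simp only [hFnorm]
    exact ((hint.norm.const_mul _).const_mul _).const_mul _
  have hFsum : Summable fun d => ∫ t, ‖F d t‖ := by
    simp only [hFnorm, MeasureTheory.integral_const_mul]
    refine Summable.of_nonneg_of_le (fun d => by positivity) (fun d => ?_)
      ((Real.summable_nat_rpow.mpr (by linarith : -σ < -1)).mul_right
        (x ^ σ * ∫ t : ℝ, ‖R (σ + t * I)‖))
    refine mul_le_of_le_one_left (by positivity) ?_
    rw [Complex.norm_intCast]
    exact_mod_cast ArithmeticFunction.abs_moebius_le_one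
  have hswap := MeasureTheory.integral_tsum_of_summable_integral_norm hFint hFsum
  have hL : ∀ t : ℝ, ∑' d, F d t = R (σ + t * I) * (x : ℂ) ^ (σ + t * I : ℂ) *
      ((σ + t * I - 1) * (riemannZeta₁ (σ + t * I))⁻¹) := by
    intro t
    simp only [hF]
    rw [tsum_mul_right, ← LSeries_moebius_eq (by simpa)]
    rw [LSeries]
    ring
  simp only [hL] at hswap
  rw [← hswap, ← tsum_mul_left]
  refine tsum_congr fun d => ?_
  rcases Nat.eq_zero_or_pos d with rfl | hd
  · simp [hF]
  have hd0 : (0 : ℝ) < d := by exact_mod_cast hd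
  have hinv := mellinInv_mellin_eq σ (fun t => (riemannRem V t : ℂ)) (x := d / x) (by positivity)
    hcv hint ((continuous_ofReal.continuousAt).comp (hda _ (by positivity)).continuousAt)
  rw [← hinv, mellinInv, real_smul, mul_left_comm, ← MeasureTheory.integral_const_mul]
  congr 2
  ext t
  simp only [hF, LSeries.term_of_ne_zero hd.ne', smul_eq_mul]
  rw [show ((d / x : ℝ) : ℂ) = (d : ℂ) / x from by push_cast; rfl, cpow_neg,
    show ((d : ℂ) / x) = ((d : ℝ) : ℂ) / ((x : ℝ) : ℂ) from rfl, 
    div_cpow_ofReal_nonneg hd0.le hx.le]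
  push_cast
  rw [inv_div]
  ring

/-- Under RH, smooth averages of Euler's totient have an error term of square-root type. -/
theorem exists_totient_bound (h : IsBump a b V) (hRH : RiemannHypothesis) {η : ℝ} (hη : 0 < η)
    (hη' : η < 1 / 2) : ∃ C, 0 ≤ C ∧ ∀ x : ℝ, 1 ≤ x →
      ‖∑' q : ℕ, (Nat.totient q : ℂ) * (V (q / x) : ℂ) -
        x ^ 2 / riemannZeta 2 * ((∫ t, t * V t : ℝ) : ℂ)‖ ≤ C * x ^ (1 / 2 + η) := by
  obtain ⟨C₁, hC₁, K, hK⟩ := exists_inv_riemannZeta₁_bound hRH hη (by linarith)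
  have hE := h.isEulerSeq_riemannRem
  obtain ⟨C₂, hC₂, hR⟩ := hE.exists_mellin_decay (K + 3) (σ₀ := 1 / 2 + η) (σ₁ := 5 / 4)
    (by linarith) (by linarith) (by norm_num)
  have hdf := fun (s : ℂ) (hs : 1 / 2 + η ≤ s.re) (hs' : s.re ≤ 5 / 4) =>
    hE.differentiableAt_mellin 0 (s := s) (by linarith) (by linarith)
  simp only [Function.iterate_zero, id] at hR hdf
  set B := C₁ * C₂ with hB
  have hB0 : 0 ≤ B := by positivity
  refine ⟨(1 / (2 * Real.pi)) * (B * ∫ t : ℝ, ((1 + |t|) ^ 2)⁻¹), ?_, fun x hx => ?_⟩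
  · have : 0 ≤ ∫ t : ℝ, ((1 + |t|) ^ 2)⁻¹ :=
      MeasureTheory.integral_nonneg fun t => by simp only [Pi.zero_apply]; positivity
    positivity
  have hx0 : 0 < x := by linarith
  have hx0' : (x : ℂ) ≠ 0 := by exact_mod_cast hx0.ne'
  rw [h.tsum_totient_eq hx0, add_sub_cancel_left,
    h.tsum_moebius_riemannRem hx0 (σ := 5 / 4) (by norm_num) (by norm_num)]
  set G : ℂ → ℂ := fun s : ℂ => mellin (fun t => (riemannRem V t : ℂ)) s *
        (x : ℂ) ^ s * ((s - 1) * (riemannZeta₁ s)⁻¹) with hG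
  have hGd : ∀ s : ℂ, 1 / 2 + η ≤ s.re → s.re ≤ 5 / 4 → DifferentiableAt ℂ G s := by
    intro s hs hs'
    refine ((hdf s hs hs').mul (differentiableAt_id.const_cpow (Or.inl hx0'))).mul
      ((differentiableAt_id.sub_const 1).mul
        ((differentiable_riemannZeta₁ s).inv (riemannZeta₁_ne_zero_of_RH hRH (by linarith))))
  have hGb : ∀ s : ℂ, 1 / 2 + η ≤ s.re → s.re ≤ 5 / 4 →
      (1 + |s.im|) ^ 2 * ‖G s‖ ≤ B * x ^ s.re := by
    intro s hs hs'
    have h1 : ‖s - 1‖ ≤ 1 + |s.im| := by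
      refine (norm_le_abs_re_add_abs_im _).trans ?_
      simp only [sub_re, one_re, sub_im, one_im, sub_zero]
      gcongr
      rw [abs_le]
      constructor <;> linarith
    have h2 := hK s hs (by linarith)
    have h3 := hR s hs hs'
    simp only [hG, norm_mul]
    rw [norm_cpow_eq_rpow_re_of_pos hx0]
    set M := ‖mellin (fun t => (riemannRem V t : ℂ)) s‖
    calc _ ≤ (1 + |s.im|) ^ 2 * (M * x ^ s.re * ((1 + |s.im|) * (C₁ * (1 + |s.im|) ^ K))) := by
          gcongr
      _ = C₁ * ((1 + |s.im|) ^ (K + 3) * M) * x ^ s.re := by ring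
      _ ≤ C₁ * C₂ * x ^ s.re := by gcongr
  have hshift := integral_vertical_eq (G := G) (σ₀ := 1 / 2 + η) (σ₁ := 5 / 4)
    (C := B * x ^ (5 / 4 : ℝ)) (by linarith) hGd (fun s hs hs' => (hGb s hs hs').trans (by gcongr))
  rw [← hshift, norm_mul, Complex.norm_real, Real.norm_of_nonneg (by positivity), mul_assoc]
  refine mul_le_mul_of_nonneg_left ?_ (by positivity)
  rw [mul_right_comm, ← MeasureTheory.integral_const_mul]
  refine MeasureTheory.norm_integral_le_of_norm_le
    (integrable_inv_one_add_abs_sq.const_mul _) (Eventually.of_forall fun t => ?_)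
  have := hGb ((1 / 2 + η : ℝ) + t * I) (by simp) (by simp; linarith)
  rw [← div_eq_mul_inv, le_div_iff₀ (by positivity), mul_comm]
  simpa using this

end IsBump

lemma mellinW_eq_mellin (V : ℝ → ℝ) : mellinW V = mellin fun t => (V t : ℂ) := by
  ext s
  simp only [mellinW, mellin, smul_eq_mul, mul_comm]

namespace IsBump

variable {a b : ℝ} {V : ℝ → ℝ}

lemma mellinW_one (h : IsBump a b V) : mellinW V 1 = ((∫ t, V t : ℝ) : ℂ) := by
  rw [mellinW]
  simp only [sub_self, cpow_zero, mul_one]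
  rw [integral_complex_ofReal]
  congr 1
  refine MeasureTheory.setIntegral_eq_integral_of_forall_compl_eq_zero fun t ht => ?_
  exact h.eq_zero_of_le (by simpa using ht)

/-- Parseval's formula for the Mellin transform of a bump function. -/
lemma VI_mellinW_mul (h : IsBump a b V) {c : ℝ} (hc : 1 < c) (hc' : c < 2) :
    VI c (fun s => mellinW V (2 - s) * mellinW V s) = ((∫ t, t * V t ^ 2 : ℝ) : ℂ) := by
  have hE := h.isEulerSeq
  have hcv := hE.mellinConvergent 0 (s := c) (by simp; linarith) (by simpa)
  have hcv2 := hE.mellinConvergent 0 (s := (2 - c : ℝ)) (by simpa) (by simp; linarith)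
  obtain ⟨C, hC0, hC⟩ := hE.exists_mellin_decay 2 (σ₀ := c) (σ₁ := c) (by linarith) le_rfl hc'
  have hdf := fun (s : ℂ) (hs : s.re = c) =>
    hE.differentiableAt_mellin 0 (s := s) (by linarith) (by linarith)
  simp only [Function.iterate_zero, id] at hcv hcv2 hC hdf
  rw [mellinW_eq_mellin]
  set R := mellin (fun t => (V t : ℂ)) with hR
  have hint : MeasureTheory.Integrable fun t : ℝ => R (c + t * I) :=
    integrable_vertical hdf fun s hs => hC s hs.ge hs.le
  set ν := MeasureTheory.volume.restrict (Set.Ioi (0 : ℝ)) with hν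
  have hprod : MeasureTheory.Integrable (Function.uncurry fun (t u : ℝ) =>
      R (c + t * I) * ((u : ℂ) ^ (2 - (c + t * I) - 1 : ℂ) * (V u : ℂ)))
      (MeasureTheory.volume.prod ν) := by
    refine (hint.mul_prod hcv2).mono ?_ ?_
    · refine MeasureTheory.AEStronglyMeasurable.mul
        (hint.1.comp_fst (f := fun t : ℝ => R (c + t * I))) ?_
      refine Measurable.aestronglyMeasurable ?_
      refine Measurable.mul (Measurable.pow ?_ ?_) ?_
      · exact measurable_ofReal.comp measurable_snd
      · exact Measurable.sub_const (measurable_const.sub (measurable_const.add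
          ((measurable_ofReal.comp measurable_fst).mul_const I))) 1
      · exact measurable_ofReal.comp (h.continuous.measurable.comp measurable_snd)
    · have hae : ∀ᵐ p : ℝ × ℝ ∂(MeasureTheory.volume.prod ν), p.2 ∈ Set.Ioi (0 : ℝ) :=
        MeasureTheory.Measure.quasiMeasurePreserving_snd.ae
          (MeasureTheory.ae_restrict_mem measurableSet_Ioi)
      filter_upwards [hae] with p hp
      simp only [Function.uncurry, norm_mul, smul_eq_mul]
      rw [norm_cpow_eq_rpow_re_of_pos hp, norm_cpow_eq_rpow_re_of_pos hp]
      simp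
  have hswap := MeasureTheory.integral_integral_swap hprod
  have hinv : ∀ u ∈ Set.Ioi (0 : ℝ), ∫ t : ℝ, R (c + t * I) *
      ((u : ℂ) ^ (2 - (c + t * I) - 1 : ℂ) * (V u : ℂ)) =
      2 * Real.pi * ((u * V u ^ 2 : ℝ) : ℂ) := by
    intro u hu
    have hu0 : (u : ℂ) ≠ 0 := by exact_mod_cast (ne_of_gt hu)
    have h1 := mellinInv_mellin_eq c (fun t => (V t : ℂ)) (x := u) hu
      hcv hint ((continuous_ofReal.comp h.continuous).continuousAt)
    rw [mellinInv, ← hR, real_smul] at h1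
    have h2 : ∫ t : ℝ, (u : ℂ) ^ (-(c + t * I) : ℂ) • R (c + t * I) = 2 * Real.pi * V u := by
      rw [← h1]
      generalize (∫ t : ℝ, (u : ℂ) ^ (-(c + t * I) : ℂ) • R (c + t * I)) = T
      push_cast
      have : (Real.pi : ℂ) ≠ 0 := by exact_mod_cast Real.pi_ne_zero
      field_simp
    have h3 : ∀ t : ℝ, R (c + t * I) * ((u : ℂ) ^ (2 - (c + t * I) - 1 : ℂ) * (V u : ℂ)) =
        (u * V u : ℂ) * ((u : ℂ) ^ (-(c + t * I) : ℂ) • R (c + t * I)) := by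
      intro t
      rw [show (2 - (c + t * I) - 1 : ℂ) = 1 + (-(c + t * I)) by ring, cpow_add _ _ hu0, cpow_one,
        smul_eq_mul]
      ring
    simp only [h3]
    rw [MeasureTheory.integral_const_mul, h2]
    push_cast
    ring
  have hfin : ∫ u in Set.Ioi (0 : ℝ), ((u * V u ^ 2 : ℝ) : ℂ) =
      ((∫ t, t * V t ^ 2 : ℝ) : ℂ) := by
    rw [integral_complex_ofReal]
    congr 1
    refine MeasureTheory.setIntegral_eq_integral_of_forall_compl_eq_zero fun t ht => ?_
    rw [h.eq_zero_of_le (by simpa using ht)]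
    simp
  rw [MeasureTheory.setIntegral_congr_fun measurableSet_Ioi hinv,
    MeasureTheory.integral_const_mul, hfin] at hswap
  have hVI : VI c (fun s => R (2 - s) * R s) = (1 / (2 * Real.pi)) *
      ∫ t : ℝ, ∫ u, R (c + t * I) * ((u : ℂ) ^ (2 - (c + t * I) - 1 : ℂ) * (V u : ℂ)) ∂ν := by
    rw [VI, MeasureTheory.integral_mul_const, ← mul_assoc]
    have : ∀ t : ℝ, R (2 - (c + t * I)) * R (c + t * I) =
        ∫ u, R (c + t * I) * ((u : ℂ) ^ (2 - (c + t * I) - 1 : ℂ) * (V u : ℂ)) ∂ν := by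
      intro t
      rw [MeasureTheory.integral_const_mul, mul_comm]
      rfl
    simp only [this]
    have hpi : (Real.pi : ℂ) ≠ 0 := by exact_mod_cast Real.pi_ne_zero
    field_simp
  rw [hVI, hswap]
  have hpi : (Real.pi : ℂ) ≠ 0 := by exact_mod_cast Real.pi_ne_zero
  field_simp

end IsBump

namespace IsBump

variable {a b : ℝ} {V : ℝ → ℝ}

lemma exists_second_difference_bound (h : IsBump a b V) :
    ∃ M, 0 ≤ M ∧ ∀ t δ, |V t - 2 * V (t - δ) + V (t - 2 * δ)| ≤ M * δ ^ 2 := by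
  obtain ⟨M, hM0, hM⟩ := h.deriv'.deriv'.exists_bound
  have lip : ∀ s t, |deriv V s - deriv V t| ≤ M * |s - t| := by
    intro s t
    have := Convex.norm_image_sub_le_of_norm_deriv_le (f := deriv V) (s := Set.univ) (x := t)
      (y := s) (fun u _ => h.deriv'.differentiable u) (fun u _ => hM u) convex_univ
      (Set.mem_univ _) (Set.mem_univ _)
    simpa using this
  refine ⟨M, hM0, fun t δ => ?_⟩
  have hd : ∀ u, HasDerivAt (fun u => V u - V (u - δ)) (deriv V u - deriv V (u - δ)) u := by
    intro u
    exact (h.differentiable u).hasDerivAt.sub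
      ((h.differentiable (u - δ)).hasDerivAt.comp_sub_const u δ)
  have := Convex.norm_image_sub_le_of_norm_hasDerivWithin_le
    (f := fun u => V u - V (u - δ)) (s := Set.univ) (x := t - δ) (y := t) (C := M * |δ|)
    (fun u _ => (hd u).hasDerivWithinAt)
    (fun u _ => by simpa using lip u (u - δ)) convex_univ (Set.mem_univ _) (Set.mem_univ _)
  have e : t - δ - δ = t - 2 * δ := by ring
  rw [Real.norm_eq_abs, Real.norm_eq_abs, sub_sub_cancel, e] at this
  rw [show V t - 2 * V (t - δ) + V (t - 2 * δ) = V t - V (t - δ) - (V (t - δ) - V (t - 2 * δ)) by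
    ring]
  refine this.trans (le_of_eq ?_)
  rw [mul_assoc, abs_mul_abs_self, sq]

lemma tsum_pow_eq (h : IsBump a b V) {y : ℝ} (hy : 0 < y) {N : ℕ} (hN : ⌊b * y⌋₊ < N) (z : ℂ) :
    ∑' n : ℕ, z ^ n * (V (n / y) : ℂ) = ∑ n ∈ Finset.range N, z ^ n * (V (n / y) : ℂ) := by
  refine tsum_eq_sum fun n hn => ?_
  rw [h.div_eq_zero hy (hN.trans_le (by simpa using hn))]
  simp

/-- Smooth exponential sums decay quadratically in the distance of the phase from `0`. -/
lemma exists_exponential_sum_bound (h : IsBump a b V) :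
    ∃ C, 0 ≤ C ∧ ∀ y, 1 ≤ y → ∀ z : ℂ, ‖z‖ = 1 →
      ‖1 - z‖ ^ 2 * ‖∑' n : ℕ, z ^ n * (V (n / y) : ℂ)‖ ≤ C / y := by
  obtain ⟨M, hM0, hM⟩ := h.exists_second_difference_bound
  have hb := h.one_le
  refine ⟨(b + 3) * M, by positivity, fun y hy z hz => ?_⟩
  have hy0 : 0 < y := by linarith
  set N := ⌊b * y⌋₊ + 1 with hN
  set v : ℝ → ℂ := fun t => (V (t / y) : ℂ) with hv
  have hvneg : ∀ t, t ≤ 0 → v t = 0 := by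
    intro t ht
    rw [hv]
    simp only
    rw [h.eq_zero_of_le (div_nonpos_of_nonpos_of_nonneg ht hy0.le), ofReal_zero]
  have hvbig : ∀ n : ℕ, N ≤ n → v n = 0 := by
    intro n hn
    rw [hv]
    simp only
    rw [h.div_eq_zero hy0 (by omega), ofReal_zero]
  have key : (1 - z) ^ 2 * ∑ n ∈ Finset.range N, z ^ n * v n =
      ∑ n ∈ Finset.range (N + 2), z ^ n * (v n - 2 * v (n - 1) + v (n - 2)) := by
    have e0 : ∑ n ∈ Finset.range (N + 2), z ^ n * v n = ∑ n ∈ Finset.range N, z ^ n * v n := by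
      rw [Finset.sum_range_succ, Finset.sum_range_succ, hvbig N le_rfl, hvbig (N + 1) (by omega)]
      simp
    have e1 : ∑ n ∈ Finset.range (N + 2), z ^ n * v (n - 1) =
        z * ∑ n ∈ Finset.range N, z ^ n * v n := by
      rw [Finset.sum_range_succ', Finset.sum_range_succ, Finset.mul_sum]
      have t1 : v (((N + 1 : ℕ) : ℝ) - 1) = 0 := by
        push_cast
        rw [add_sub_cancel_right]
        exact hvbig N le_rfl
      rw [t1, hvneg _ (by simp)]
      simp only [mul_zero, add_zero]
      refine Finset.sum_congr rfl fun n _ => ?_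
      push_cast
      rw [add_sub_cancel_right]
      ring
    have e2 : ∑ n ∈ Finset.range (N + 2), z ^ n * v (n - 2) =
        z ^ 2 * ∑ n ∈ Finset.range N, z ^ n * v n := by
      rw [Finset.sum_range_succ', Finset.sum_range_succ', Finset.mul_sum, hvneg _ (by simp),
        hvneg _ (by norm_num)]
      simp only [mul_zero, add_zero]
      refine Finset.sum_congr rfl fun n _ => ?_
      push_cast
      rw [show (n : ℝ) + 1 + 1 - 2 = n by ring]
      ring
    have e3 : ∀ n : ℕ, z ^ n * (v n - 2 * v (n - 1) + v (n - 2)) =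
        z ^ n * v n - 2 * (z ^ n * v (n - 1)) + z ^ n * v (n - 2) := fun n => by ring
    simp only [e3]
    rw [Finset.sum_add_distrib, Finset.sum_sub_distrib, ← Finset.mul_sum, e0, e1, e2]
    ring
  rw [h.tsum_pow_eq hy0 (N := N) (by omega), ← norm_pow, ← norm_mul, key]
  have hterm : ∀ n ∈ Finset.range (N + 2),
      ‖z ^ n * (v n - 2 * v (n - 1) + v (n - 2))‖ ≤ M / y ^ 2 := by
    intro n _
    rw [norm_mul, norm_pow, hz, one_pow, one_mul]
    have h1 := hM (n / y) (1 / y)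
    rw [show (n : ℝ) / y - 1 / y = (n - 1) / y by ring,
      show (n : ℝ) / y - 2 * (1 / y) = (n - 2) / y by ring] at h1
    rw [show v n - 2 * v (n - 1) + v (n - 2) =
      ((V (n / y) - 2 * V ((n - 1) / y) + V ((n - 2) / y) : ℝ) : ℂ) by simp [hv],
      Complex.norm_real, Real.norm_eq_abs]
    refine h1.trans (le_of_eq ?_)
    ring
  refine (norm_sum_le_of_le _ hterm).trans ?_
  rw [Finset.sum_const, Finset.card_range, nsmul_eq_mul]
  have h2 : ((N + 2 : ℕ) : ℝ) ≤ (b + 3) * y := by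
    have : (⌊b * y⌋₊ : ℝ) ≤ b * y := Nat.floor_le (by positivity)
    rw [hN]
    push_cast
    nlinarith
  calc ((N + 2 : ℕ) : ℝ) * (M / y ^ 2) ≤ ((b + 3) * y) * (M / y ^ 2) := by gcongr
    _ = (b + 3) * M / y := by field_simp

end IsBump

lemma norm_one_sub_exp_ge (t : ℝ) (j : ℤ) (ht : |t - j| ≤ 1 / 2) :
    4 * |t - j| ≤ ‖1 - exp (2 * Real.pi * I * t)‖ := by
  have h1 : exp (2 * Real.pi * I * t) = exp (I * ((2 * Real.pi * (t - j) : ℝ) : ℂ)) := by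
    rw [exp_eq_exp_iff_exists_int]
    refine ⟨j, ?_⟩
    push_cast
    ring
  rw [h1, norm_sub_rev, Complex.norm_exp_I_mul_ofReal_sub_one]
  rw [show 2 * Real.pi * (t - j) / 2 = Real.pi * (t - j) by ring, norm_mul, Real.norm_eq_abs,
    Real.norm_eq_abs, abs_of_pos (two_pos : (0 : ℝ) < 2)]
  have hpi := Real.pi_pos
  have h2 : |Real.pi * (t - j)| ≤ Real.pi / 2 := by
    rw [abs_mul, abs_of_pos hpi]
    nlinarith
  have h3 := Real.mul_abs_le_abs_sin h2
  rw [abs_mul, abs_of_pos hpi, ← mul_assoc, div_mul_cancel₀ _ hpi.ne'] at h3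
  linarith

/-- A bound for the reciprocal of `‖1 - e(t)‖²` on `[0, 2)` away from the integers. -/
lemma inv_norm_one_sub_exp_sq_le {t : ℝ} (h0 : 0 ≤ t) (h2 : t < 2)
    (ht : exp (2 * Real.pi * I * t) ≠ 1) :
    (‖1 - exp (2 * Real.pi * I * t)‖ ^ 2)⁻¹ ≤
      ∑ j ∈ Finset.range 3, ((t - j) ^ 2)⁻¹ := by
  have hne : ∀ j : ℕ, t - j ≠ 0 := by
    intro j hj
    refine ht ?_
    rw [sub_eq_zero.mp hj, exp_eq_one_iff]
    exact ⟨j, by push_cast; ring⟩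
  have main : ∀ j ∈ Finset.range 3, |t - j| ≤ 1 / 2 →
      (‖1 - exp (2 * Real.pi * I * t)‖ ^ 2)⁻¹ ≤ ∑ j ∈ Finset.range 3, ((t - j) ^ 2)⁻¹ := by
    intro j hj hjt
    have h1 := norm_one_sub_exp_ge t j (by exact_mod_cast hjt)
    have hpos : 0 < |t - j| := abs_pos.mpr (hne j)
    calc (‖1 - exp (2 * Real.pi * I * t)‖ ^ 2)⁻¹ ≤ (|t - j| ^ 2)⁻¹ := by
          gcongr
          rw [Int.cast_natCast] at h1
          linarith
      _ = ((t - j) ^ 2)⁻¹ := by rw [sq_abs]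
      _ ≤ _ := Finset.single_le_sum (f := fun j : ℕ => ((t - j) ^ 2)⁻¹)
        (fun i _ => by positivity) hj
  rcases le_or_gt t (1 / 2) with h | h
  · exact main 0 (by simp) (by rw [abs_le]; constructor <;> push_cast <;> linarith)
  rcases le_or_gt t (3 / 2) with h' | h'
  · exact main 1 (by simp) (by rw [abs_le]; constructor <;> push_cast <;> linarith)
  · exact main 2 (by simp) (by rw [abs_le]; constructor <;> push_cast <;> linarith)

lemma summable_inv_one_add_int_sq : Summable fun k : ℤ => (1 + (k : ℝ) ^ 2)⁻¹ := by
  refine Summable.of_norm_bounded_eventually (g := fun k : ℤ => 1 / (k : ℝ) ^ 2)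
    (Real.summable_one_div_int_pow.mpr (by norm_num)) ?_
  filter_upwards [(Set.finite_singleton (0 : ℤ)).compl_mem_cofinite] with k hk
  have hk0 : (k : ℝ) ≠ 0 := by exact_mod_cast hk
  rw [Real.norm_of_nonneg (by positivity), one_div]
  gcongr
  linarith

/-- Sums of inverse squares over well-spaced points. -/
lemma sum_inv_sq_le_of_separated {ι : Type*} (s : Finset ι) (u : ι → ℝ) {δ : ℝ} (hδ : 0 < δ)
    (h0 : ∀ i ∈ s, δ ≤ |u i|) (hsep : ∀ i ∈ s, ∀ j ∈ s, i ≠ j → δ ≤ |u i - u j|) :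
    ∑ i ∈ s, (u i ^ 2)⁻¹ ≤ 5 * (∑' k : ℤ, (1 + (k : ℝ) ^ 2)⁻¹) * (δ ^ 2)⁻¹ := by
  classical
  have hinj : Set.InjOn (fun i => ⌊u i / δ⌋) s := by
    intro i hi j hj hij
    by_contra hne
    have h1 := Int.abs_sub_lt_one_of_floor_eq_floor hij
    rw [← sub_div, abs_div, abs_of_pos hδ, div_lt_one hδ] at h1
    linarith [hsep i hi j hj hne]
  have hterm : ∀ i ∈ s, (u i ^ 2)⁻¹ ≤ 5 * (δ ^ 2)⁻¹ * (1 + (⌊u i / δ⌋ : ℝ) ^ 2)⁻¹ := by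
    intro i hi
    have hu : 0 < |u i| := hδ.trans_le (h0 i hi)
    have hu2 : 0 < u i ^ 2 := by rw [← sq_abs]; positivity
    set r := u i / δ with hr
    have hr1 : 1 ≤ |r| := by
      rw [hr, abs_div, abs_of_pos hδ, le_div_iff₀ hδ, one_mul]
      exact h0 i hi
    have hk : |(⌊r⌋ : ℝ)| ≤ |r| + 1 := by
      have e1 := Int.floor_le r
      have e2 := Int.lt_floor_add_one r
      have e3 := neg_abs_le r
      have e4 := le_abs_self r
      rw [abs_le]
      constructor <;> linarith
    have hk2 : 1 + (⌊r⌋ : ℝ) ^ 2 ≤ 5 * r ^ 2 := by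
      rw [← sq_abs (⌊r⌋ : ℝ), ← sq_abs r]
      have := abs_nonneg (⌊r⌋ : ℝ)
      nlinarith
    have hur : u i ^ 2 = r ^ 2 * δ ^ 2 := by rw [hr]; field_simp
    have hr2 : 0 < r ^ 2 := by rw [← sq_abs]; positivity
    rw [hur, mul_inv, mul_comm, mul_right_comm, mul_comm _ (δ ^ 2)⁻¹]
    refine mul_le_mul_of_nonneg_left ?_ (by positivity)
    rw [← div_eq_mul_inv, le_div_iff₀ (by positivity), inv_mul_le_iff₀ hr2]
    linarith
  calc ∑ i ∈ s, (u i ^ 2)⁻¹ ≤ ∑ i ∈ s, 5 * (δ ^ 2)⁻¹ * (1 + (⌊u i / δ⌋ : ℝ) ^ 2)⁻¹ :=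
        Finset.sum_le_sum hterm
    _ = 5 * (δ ^ 2)⁻¹ * ∑ k ∈ s.image (fun i => ⌊u i / δ⌋), (1 + (k : ℝ) ^ 2)⁻¹ := by
        rw [← Finset.mul_sum, Finset.sum_image hinj]
    _ ≤ 5 * (δ ^ 2)⁻¹ * ∑' k : ℤ, (1 + (k : ℝ) ^ 2)⁻¹ := by
        gcongr
        exact summable_inv_one_add_int_sq.sum_le_tsum _ (fun k _ => by positivity)
    _ = _ := by ring

lemma inv_sq_le_abs_add_div {a b : ℤ} {q r Q : ℕ} (hq : 0 < q) (hr : 0 < r) (hqQ : q ≤ Q)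
    (hrQ : r ≤ Q) (h : (a : ℝ) / q + (b : ℝ) / r ≠ 0) :
    ((Q : ℝ) ^ 2)⁻¹ ≤ |(a : ℝ) / q + (b : ℝ) / r| := by
  have hq' : (0 : ℝ) < q := by exact_mod_cast hq
  have hr' : (0 : ℝ) < r := by exact_mod_cast hr
  have e : (a : ℝ) / q + (b : ℝ) / r = ((a * r + b * q : ℤ) : ℝ) / (q * r) := by
    push_cast
    field_simp
  rw [e] at h ⊢
  have hn : a * r + b * q ≠ 0 := by
    rintro h0
    rw [h0] at h
    simp at h
  have h1 : (1 : ℝ) ≤ |((a * r + b * q : ℤ) : ℝ)| := by exact_mod_cast Int.one_le_abs hn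
  rw [abs_div, abs_of_pos (by positivity : (0 : ℝ) < q * r), inv_eq_one_div]
  have hqQ' : (q : ℝ) ≤ Q := by exact_mod_cast hqQ
  have hrQ' : (r : ℝ) ≤ Q := by exact_mod_cast hrQ
  gcongr
  nlinarith

/-- The pairs `(q, a)` indexing the reduced fractions `a / q` in `[0, 1)` with `q ≤ Q`. -/
def fareyIndex (Q : ℕ) : Finset (Σ _ : ℕ, ℕ) :=
  (Finset.Ioc 0 Q).sigma fun q => (Finset.range q).filter fun a => Nat.Coprime a q

/-- The fraction `a / q` attached to the pair `(q, a)`. -/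
noncomputable def pairFrac (p : Σ _ : ℕ, ℕ) : ℝ := (p.2 : ℝ) / p.1

/-- The root of unity `e(a / q)` attached to the pair `(q, a)`. -/
noncomputable def pairRoot (p : Σ _ : ℕ, ℕ) : ℂ := exp (2 * Real.pi * I * (pairFrac p : ℂ))

lemma mem_fareyIndex {Q : ℕ} {p : Σ _ : ℕ, ℕ} :
    p ∈ fareyIndex Q ↔ (0 < p.1 ∧ p.1 ≤ Q) ∧ p.2 < p.1 ∧ Nat.Coprime p.2 p.1 := by
  simp [fareyIndex]

lemma norm_pairRoot (p : Σ _ : ℕ, ℕ) : ‖pairRoot p‖ = 1 := by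
  rw [pairRoot, show (2 * Real.pi * I * (pairFrac p : ℂ)) = ((2 * Real.pi * pairFrac p : ℝ) : ℂ) * I
    by push_cast; ring, norm_exp_ofReal_mul_I]

lemma pairRoot_mul (p p' : Σ _ : ℕ, ℕ) :
    pairRoot p * pairRoot p' = exp (2 * Real.pi * I * ((pairFrac p + pairFrac p' : ℝ) : ℂ)) := by
  rw [pairRoot, pairRoot, ← Complex.exp_add]
  congr 1
  push_cast
  ring

lemma card_fareyIndex_le (Q : ℕ) : (fareyIndex Q).card ≤ Q ^ 2 := by
  rw [fareyIndex, Finset.card_sigma, sq]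
  calc ∑ q ∈ Finset.Ioc 0 Q, ((Finset.range q).filter fun a => Nat.Coprime a q).card
      ≤ ∑ q ∈ Finset.Ioc 0 Q, Q := by
        refine Finset.sum_le_sum fun q hq => ?_
        refine (Finset.card_filter_le _ _).trans ?_
        rw [Finset.card_range]
        exact (Finset.mem_Ioc.mp hq).2
    _ = Q * Q := by simp

section

variable {Q : ℕ} {p p' : Σ _ : ℕ, ℕ}

lemma pairFrac_nonneg (p : Σ _ : ℕ, ℕ) : 0 ≤ pairFrac p := by
  rw [pairFrac]; positivity

lemma pairFrac_lt_one (hp : p ∈ fareyIndex Q) : pairFrac p < 1 := by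
  obtain ⟨⟨h1, -⟩, h2, -⟩ := mem_fareyIndex.mp hp
  rw [pairFrac, div_lt_one (by exact_mod_cast h1)]
  exact_mod_cast h2

lemma eq_of_pairFrac_eq (hp : p ∈ fareyIndex Q) (hp' : p' ∈ fareyIndex Q)
    (h : pairFrac p = pairFrac p') : p = p' := by
  obtain ⟨⟨h1, -⟩, h2, h3⟩ := mem_fareyIndex.mp hp
  obtain ⟨⟨h1', -⟩, h2', h3'⟩ := mem_fareyIndex.mp hp'
  obtain ⟨q, a⟩ := p
  obtain ⟨q', a'⟩ := p'
  simp only [pairFrac] at *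
  rw [div_eq_div_iff (by exact_mod_cast h1.ne') (by exact_mod_cast h1'.ne')] at h
  have h4 : a * q' = a' * q := by exact_mod_cast h
  have d1 : q ∣ q' := h3.symm.dvd_of_dvd_mul_left (Dvd.intro_left a' h4.symm)
  have d2 : q' ∣ q := h3'.symm.dvd_of_dvd_mul_left (Dvd.intro_left a h4)
  obtain rfl := Nat.dvd_antisymm d1 d2
  obtain rfl := Nat.eq_of_mul_eq_mul_right h1 h4
  rfl

lemma pairFrac_separated (hp : p ∈ fareyIndex Q) (hp' : p' ∈ fareyIndex Q) (hne : p ≠ p') :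
    ((Q : ℝ) ^ 2)⁻¹ ≤ |pairFrac p - pairFrac p'| := by
  obtain ⟨⟨h1, h2⟩, -⟩ := mem_fareyIndex.mp hp
  obtain ⟨⟨h1', h2'⟩, -⟩ := mem_fareyIndex.mp hp'
  have h3 : pairFrac p - pairFrac p' ≠ 0 := fun h =>
    hne (eq_of_pairFrac_eq hp hp' (sub_eq_zero.mp h))
  have e : pairFrac p - pairFrac p' = ((p.2 : ℤ) : ℝ) / p.1 + ((-(p'.2 : ℤ) : ℤ) : ℝ) / p'.1 := by
    simp only [pairFrac]
    push_cast
    ring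
  rw [e] at h3 ⊢
  exact inv_sq_le_abs_add_div h1 h1' h2 h2' h3

lemma pairFrac_add_separated (hp : p ∈ fareyIndex Q) (hp' : p' ∈ fareyIndex Q) {j : ℕ}
    (h : pairFrac p' + pairFrac p - j ≠ 0) :
    ((Q : ℝ) ^ 2)⁻¹ ≤ |pairFrac p' + pairFrac p - j| := by
  obtain ⟨⟨h1, h2⟩, -⟩ := mem_fareyIndex.mp hp
  obtain ⟨⟨h1', h2'⟩, -⟩ := mem_fareyIndex.mp hp'
  have hq : (p.1 : ℝ) ≠ 0 := by exact_mod_cast h1.ne'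
  have e : pairFrac p' + pairFrac p - j =
      ((p'.2 : ℤ) : ℝ) / p'.1 + (((p.2 : ℤ) - j * p.1 : ℤ) : ℝ) / p.1 := by
    simp only [pairFrac]
    push_cast
    field_simp
    ring
  rw [e] at h ⊢
  exact inv_sq_le_abs_add_div h1' h1 h2' h2 h

lemma eq_of_pairRoot_eq (hp : p ∈ fareyIndex Q) (hp' : p' ∈ fareyIndex Q)
    (h : pairRoot p = pairRoot p') : p = p' := by
  rw [pairRoot, pairRoot, exp_eq_exp_iff_exists_int] at h
  obtain ⟨n, hn⟩ := h
  have h1 : pairFrac p = pairFrac p' + n := by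
    have hc : (2 * Real.pi * I : ℂ) ≠ 0 := two_pi_I_ne_zero
    have : (pairFrac p : ℂ) = pairFrac p' + n := by
      apply mul_left_cancel₀ hc
      rw [hn]
      ring
    exact_mod_cast this
  have b1 := pairFrac_nonneg p
  have b2 := pairFrac_nonneg p'
  have b3 := pairFrac_lt_one hp
  have b4 := pairFrac_lt_one hp'
  have hn1 : (n : ℝ) < 1 := by linarith
  have hn2 : (-1 : ℝ) < n := by linarith
  have hn1' : n < 1 := by exact_mod_cast hn1
  have hn2' : -1 < n := by exact_mod_cast hn2
  obtain rfl : n = 0 := by omega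
  exact eq_of_pairFrac_eq hp hp' (by simpa using h1)

/-- The reflection `a / q ↦ -a / q` modulo one. -/
lemma exists_pairRoot_mul_eq_one (hp : p ∈ fareyIndex Q) :
    ∃ p' ∈ fareyIndex Q, p'.1 = p.1 ∧ pairRoot p * pairRoot p' = 1 := by
  obtain ⟨⟨h1, h2⟩, h3, h4⟩ := mem_fareyIndex.mp hp
  have hq : (p.1 : ℝ) ≠ 0 := by exact_mod_cast h1.ne'
  rcases Nat.eq_zero_or_pos p.2 with h0 | h0
  · refine ⟨p, hp, rfl, ?_⟩
    rw [pairRoot, pairFrac, h0]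
    simp
  · refine ⟨⟨p.1, p.1 - p.2⟩, mem_fareyIndex.mpr ⟨⟨h1, h2⟩, ?_, ?_⟩, rfl, ?_⟩
    · simp only; omega
    · simp only
      exact (Nat.coprime_self_sub_left h3.le).mpr h4
    · rw [pairRoot_mul, exp_eq_one_iff]
      refine ⟨1, ?_⟩
      have : pairFrac p + pairFrac ⟨p.1, p.1 - p.2⟩ = 1 := by
        simp only [pairFrac]
        rw [Nat.cast_sub h3.le]
        field_simp
        ring
      rw [this]
      push_cast
      ring

end

lemma sum_diagonal {Q : ℕ} {p : Σ _ : ℕ, ℕ} (hp : p ∈ fareyIndex Q) (g : ℕ → ℂ) :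
    ∑ p' ∈ (fareyIndex Q).filter (fun p' => pairRoot p * pairRoot p' = 1), g p'.1 = g p.1 := by
  obtain ⟨r, hr, hr1, hr2⟩ := exists_pairRoot_mul_eq_one hp
  have : (fareyIndex Q).filter (fun p' => pairRoot p * pairRoot p' = 1) = {r} := by
    ext p'
    simp only [Finset.mem_filter, Finset.mem_singleton]
    constructor
    · rintro ⟨h1, h2⟩
      refine eq_of_pairRoot_eq h1 hr ?_
      have hne : pairRoot p ≠ 0 := exp_ne_zero _
      exact mul_left_cancel₀ hne (h2.trans hr2.symm)
    · rintro rfl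
      exact ⟨hr, hr2⟩
  rw [this, Finset.sum_singleton, hr1]

/-- The off-diagonal pairs of Farey fractions contribute at most the sixth power of the order. -/
lemma exists_offDiagonal_bound : ∃ C : ℝ, 0 ≤ C ∧ ∀ Q : ℕ,
    ∑ p ∈ fareyIndex Q, ∑ p' ∈ (fareyIndex Q).filter (fun p' => ¬ pairRoot p * pairRoot p' = 1),
      (‖1 - pairRoot p * pairRoot p'‖ ^ 2)⁻¹ ≤ C * (Q : ℝ) ^ 6 := by
  set S : ℝ := ∑' k : ℤ, (1 + (k : ℝ) ^ 2)⁻¹ with hS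
  have hS0 : 0 ≤ S := tsum_nonneg fun k => by positivity
  refine ⟨15 * S, by positivity, fun Q => ?_⟩
  rcases Nat.eq_zero_or_pos Q with rfl | hQ
  · simp [show fareyIndex 0 = ∅ from rfl]
  have hQ' : (0 : ℝ) < Q := by exact_mod_cast hQ
  have inner : ∀ p ∈ fareyIndex Q,
      ∑ p' ∈ (fareyIndex Q).filter (fun p' => ¬ pairRoot p * pairRoot p' = 1),
        (‖1 - pairRoot p * pairRoot p'‖ ^ 2)⁻¹ ≤ 15 * S * (Q : ℝ) ^ 4 := by
    intro p hp
    set T := (fareyIndex Q).filter (fun p' => ¬ pairRoot p * pairRoot p' = 1) with hT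
    have hmem : ∀ p' ∈ T, p' ∈ fareyIndex Q ∧ ¬ pairRoot p * pairRoot p' = 1 := fun p' h =>
      Finset.mem_filter.mp h
    have hj : ∀ j ∈ Finset.range 3, ∑ p' ∈ T, ((pairFrac p' + pairFrac p - (j : ℕ)) ^ 2)⁻¹ ≤
        5 * S * (Q : ℝ) ^ 4 := by
      intro j _
      have := sum_inv_sq_le_of_separated T (fun p' => pairFrac p' + pairFrac p - (j : ℕ))
        (δ := ((Q : ℝ) ^ 2)⁻¹) (by positivity) ?_ ?_
      · refine this.trans (le_of_eq ?_)
        rw [← hS, inv_pow, inv_inv]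
        ring
      · intro p' hp'
        refine pairFrac_add_separated hp (hmem p' hp').1 fun h0 => (hmem p' hp').2 ?_
        rw [pairRoot_mul, add_comm (pairFrac p), sub_eq_zero.mp h0, exp_eq_one_iff]
        exact ⟨j, by push_cast; ring⟩
      · intro r hr r' hr' hne
        simp only [sub_sub_sub_cancel_right, add_sub_add_right_eq_sub]
        exact pairFrac_separated (hmem r hr).1 (hmem r' hr').1 hne
    calc ∑ p' ∈ T, (‖1 - pairRoot p * pairRoot p'‖ ^ 2)⁻¹
        ≤ ∑ p' ∈ T, ∑ j ∈ Finset.range 3, ((pairFrac p' + pairFrac p - (j : ℕ)) ^ 2)⁻¹ := by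
          refine Finset.sum_le_sum fun p' hp' => ?_
          have h1 := (hmem p' hp').2
          rw [pairRoot_mul, add_comm (pairFrac p)] at h1 ⊢
          refine inv_norm_one_sub_exp_sq_le ?_ ?_ h1
          · linarith [pairFrac_nonneg p, pairFrac_nonneg p']
          · linarith [pairFrac_lt_one hp, pairFrac_lt_one (hmem p' hp').1]
      _ = ∑ j ∈ Finset.range 3, ∑ p' ∈ T, ((pairFrac p' + pairFrac p - (j : ℕ)) ^ 2)⁻¹ :=
          Finset.sum_comm
      _ ≤ ∑ j ∈ Finset.range 3, 5 * S * (Q : ℝ) ^ 4 := Finset.sum_le_sum hj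
      _ = 15 * S * (Q : ℝ) ^ 4 := by simp; ring
  calc _ ≤ ∑ p ∈ fareyIndex Q, 15 * S * (Q : ℝ) ^ 4 := Finset.sum_le_sum inner
    _ = (fareyIndex Q).card * (15 * S * (Q : ℝ) ^ 4) := by simp
    _ ≤ (Q : ℝ) ^ 2 * (15 * S * (Q : ℝ) ^ 4) := by
      gcongr
      exact_mod_cast card_fareyIndex_le Q
    _ = _ := by ring

lemma tsum_pnat_eq_tsum_nat {f : ℕ → ℂ} (h0 : f 0 = 0) : ∑' n : ℕ+, f n = ∑' n : ℕ, f n := by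
  refine tsum_subtype_eq_of_support_subset (f := f) (s := {n : ℕ | 0 < n}) fun n hn => ?_
  refine Nat.pos_of_ne_zero ?_
  rintro rfl
  exact hn h0

lemma Weight.isBump {U : ℝ} (W : Weight U) (hU : 2 ≤ U) :
    IsBump (1 / (2 * U)) (1 + 1 / (2 * U)) W.toFun where
  pos := by positivity
  one_le := by
    have : 0 < 1 / (2 * U) := by positivity
    linarith
  smooth := W.smooth
  supp := W.support_subset

lemma ramanujanSum_eq (q n : ℕ) :
    ramanujanSum q n =
      ∑ a ∈ (Finset.range q).filter (fun a => Nat.Coprime a q), pairRoot ⟨q, a⟩ ^ n := by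
  refine Finset.sum_congr rfl fun a _ => ?_
  rw [pairRoot, ← Complex.exp_nat_mul, pairFrac]
  congr 1
  push_cast
  ring

namespace IsBump

variable {a b : ℝ} {V : ℝ → ℝ}

lemma tsum_ramanujanSum_mul (h : IsBump a b V) {x : ℝ} (hx : 0 < x) (n : ℕ) :
    ∑' q : ℕ+, ramanujanSum q n * (V ((q : ℕ) / x) : ℂ) =
      ∑ p ∈ fareyIndex ⌊b * x⌋₊, (V (p.1 / x) : ℂ) * pairRoot p ^ n := by
  rw [tsum_pnat_eq_tsum_nat (f := fun q => ramanujanSum q n * (V (q / x) : ℂ))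
    (by simp [h.eq_zero_of_le le_rfl]), fareyIndex, Finset.sum_sigma,
    tsum_eq_sum (s := Finset.Ioc 0 ⌊b * x⌋₊)]
  · refine Finset.sum_congr rfl fun q _ => ?_
    rw [ramanujanSum_eq, Finset.sum_mul]
    exact Finset.sum_congr rfl fun a _ => mul_comm _ _
  · intro q hq
    rcases Nat.eq_zero_or_pos q with rfl | hq0
    · simp [h.eq_zero_of_le le_rfl]
    · rw [h.div_eq_zero hx (by simp at hq; exact hq hq0)]
      simp

lemma sum_sq_fareyIndex (h : IsBump a b V) {x : ℝ} (hx : 0 < x) :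
    ∑ p ∈ fareyIndex ⌊b * x⌋₊, (V (p.1 / x) : ℂ) ^ 2 =
      ∑' q : ℕ, (Nat.totient q : ℂ) * ((V (q / x) ^ 2 : ℝ) : ℂ) := by
  rw [fareyIndex, Finset.sum_sigma, tsum_eq_sum (s := Finset.Ioc 0 ⌊b * x⌋₊)]
  · refine Finset.sum_congr rfl fun q _ => ?_
    simp only [Finset.sum_const, nsmul_eq_mul]
    rw [Nat.totient]
    simp only [Nat.coprime_comm (n := q)]
    push_cast
    rfl
  · intro q hq
    rcases Nat.eq_zero_or_pos q with rfl | hq0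
    · simp
    · rw [h.div_eq_zero hx (by simp at hq; exact hq hq0)]
      simp

lemma sq (h : IsBump a b V) : IsBump a b fun t => V t ^ 2 := by
  simpa only [_root_.sq] using h.mul_left h.smooth

/-- Riemann sums at scale `1 / y`. -/
lemma exists_tsum_bound (h : IsBump a b V) :
    ∃ C, 0 ≤ C ∧ ∀ y : ℝ, 1 ≤ y →
      ‖∑' n : ℕ, (V (n / y) : ℂ) - y * ((∫ t, V t : ℝ) : ℂ)‖ ≤ C := by
  obtain ⟨C, hC0, hC⟩ := h.exists_riemann_sum_bound
  refine ⟨C, hC0, fun y hy => ?_⟩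
  have hy0 : 0 < y := by linarith
  have h1 := hC (1 / y) (by positivity) (((div_le_one hy0).mpr hy).trans h.one_le)
  simp only [mul_one_div] at h1
  rw [← ofReal_tsum, ← ofReal_mul, ← ofReal_sub, Complex.norm_real, Real.norm_eq_abs]
  have e : ∑' n : ℕ, V (n / y) - y * ∫ t, V t =
      y * (1 / y * ∑' n : ℕ, V (n / y) - ∫ t, V t) := by
    field_simp
  rw [e, abs_mul, abs_of_pos hy0]
  calc y * |1 / y * ∑' n : ℕ, V (n / y) - ∫ t, V t| ≤ y * (C * (1 / y) ^ 2) := by gcongr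
    _ = C / y := by field_simp
    _ ≤ C := div_le_self hC0 hy

end IsBump

lemma Cxy_eq_sum {U : ℝ} (W : Weight U) (hU : 2 ≤ U) {x y : ℝ} (hx : 0 < x) (hy : 0 < y) :
    Cxy W x y = ∑ p ∈ fareyIndex ⌊(1 + 1 / (2 * U)) * x⌋₊,
      ∑ p' ∈ fareyIndex ⌊(1 + 1 / (2 * U)) * x⌋₊,
        (W.toFun (p.1 / x) : ℂ) * (W.toFun (p'.1 / x) : ℂ) *
          ∑' n : ℕ, (pairRoot p * pairRoot p') ^ n * (W.toFun (n / y) : ℂ) := by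
  have hW := W.isBump hU
  set P := fareyIndex ⌊(1 + 1 / (2 * U)) * x⌋₊ with hP
  set N := ⌊(1 + 1 / (2 * U)) * y⌋₊ + 1 with hN
  rw [Cxy]
  simp only [hW.tsum_ramanujanSum_mul hx, ← hP]
  rw [tsum_pnat_eq_tsum_nat (f := fun n => (∑ p ∈ P, (W.toFun (p.1 / x) : ℂ) * pairRoot p ^ n) ^ 2 *
    (W.toFun (n / y) : ℂ)) (by simp [hW.eq_zero_of_le le_rfl])]
  simp only [hW.tsum_pow_eq hy (Nat.lt_succ_self _)]
  rw [tsum_eq_sum (s := Finset.range N) fun n hn => by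
    rw [hW.div_eq_zero hy (by simpa [hN, Nat.succ_le_iff] using hn)]; simp]
  simp only [sq, Finset.sum_mul, Finset.mul_sum]
  rw [Finset.sum_comm]
  refine Finset.sum_congr rfl fun p _ => ?_
  rw [Finset.sum_comm]
  refine Finset.sum_congr rfl fun p' _ => Finset.sum_congr rfl fun n _ => ?_
  ring

/-- The diagonal approximation to the second moment. -/
lemma exists_Cxy_sub_diagonal_bound {U : ℝ} (W : Weight U) (hU : 2 ≤ U) :
    ∃ C, 0 ≤ C ∧ ∀ x y : ℝ, 1 ≤ x → 1 ≤ y →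
      ‖Cxy W x y - (∑' q : ℕ, (Nat.totient q : ℂ) * ((W.toFun (q / x) ^ 2 : ℝ) : ℂ)) *
        ∑' n : ℕ, (W.toFun (n / y) : ℂ)‖ ≤ C * (x ^ 6 / y) := by
  have hW := W.isBump hU
  obtain ⟨C₁, hC₁, hT⟩ := hW.exists_exponential_sum_bound
  obtain ⟨C₂, hC₂, hoff⟩ := exists_offDiagonal_bound
  refine ⟨C₁ * C₂ * 64, by positivity, fun x y hx hy => ?_⟩
  have hx0 : 0 < x := by linarith
  have hy0 : 0 < y := by linarith
  set Q := ⌊(1 + 1 / (2 * U)) * x⌋₊ with hQ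
  have hQx : (Q : ℝ) ≤ 2 * x := by
    refine (Nat.floor_le (by positivity)).trans ?_
    have : 1 / (2 * U) ≤ 1 := by rw [div_le_one (by positivity)]; linarith
    gcongr
    linarith
  set T : ℂ → ℂ := fun z => ∑' n : ℕ, z ^ n * (W.toFun (n / y) : ℂ) with hTdef
  have hT1 : ∑' n : ℕ, (W.toFun (n / y) : ℂ) = T 1 := by simp [hTdef]
  have hnorm : ∀ t, ‖(W.toFun t : ℂ)‖ ≤ 1 := fun t => by
    rw [Complex.norm_real, Real.norm_of_nonneg (W.nonneg t)]
    exact W.le_one t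
  have hdiag : ∑ p ∈ fareyIndex Q, ∑ p' ∈ (fareyIndex Q).filter
      (fun p' => pairRoot p * pairRoot p' = 1),
      (W.toFun (p.1 / x) : ℂ) * (W.toFun (p'.1 / x) : ℂ) * T (pairRoot p * pairRoot p') =
      (∑' q : ℕ, (Nat.totient q : ℂ) * ((W.toFun (q / x) ^ 2 : ℝ) : ℂ)) * T 1 := by
    rw [← hW.sum_sq_fareyIndex hx0, Finset.sum_mul]
    refine Finset.sum_congr rfl fun p hp => ?_
    rw [Finset.sum_congr rfl fun p' hp' => by rw [(Finset.mem_filter.mp hp').2],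
      ← Finset.sum_mul, ← Finset.mul_sum, sum_diagonal hp fun q => (W.toFun (q / x) : ℂ)]
    ring
  have hsplit : Cxy W x y -
      (∑' q : ℕ, (Nat.totient q : ℂ) * ((W.toFun (q / x) ^ 2 : ℝ) : ℂ)) * T 1 =
      ∑ p ∈ fareyIndex Q, ∑ p' ∈ (fareyIndex Q).filter
        (fun p' => ¬ pairRoot p * pairRoot p' = 1),
        (W.toFun (p.1 / x) : ℂ) * (W.toFun (p'.1 / x) : ℂ) * T (pairRoot p * pairRoot p') := by
    rw [← hdiag, Cxy_eq_sum W hU hx0 hy0, ← Finset.sum_sub_distrib]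
    refine Finset.sum_congr rfl fun p _ => ?_
    rw [← Finset.sum_filter_add_sum_filter_not (fareyIndex Q)
      (fun p' => pairRoot p * pairRoot p' = 1), add_sub_cancel_left]
  rw [hT1, hsplit]
  have hterm : ∀ p ∈ fareyIndex Q, ∀ p' ∈ (fareyIndex Q).filter
      (fun p' => ¬ pairRoot p * pairRoot p' = 1),
      ‖(W.toFun (p.1 / x) : ℂ) * (W.toFun (p'.1 / x) : ℂ) * T (pairRoot p * pairRoot p')‖ ≤
        C₁ / y * (‖1 - pairRoot p * pairRoot p'‖ ^ 2)⁻¹ := by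
    intro p _ p' hp'
    have hz := (Finset.mem_filter.mp hp').2
    have hpos : 0 < ‖1 - pairRoot p * pairRoot p'‖ :=
      norm_pos_iff.mpr (sub_ne_zero.mpr (Ne.symm hz))
    have h1 := hT y hy (pairRoot p * pairRoot p') (by simp [norm_pairRoot])
    rw [norm_mul, norm_mul, ← div_eq_mul_inv, le_div_iff₀ (by positivity)]
    calc _ ≤ 1 * 1 * ‖T (pairRoot p * pairRoot p')‖ * ‖1 - pairRoot p * pairRoot p'‖ ^ 2 := by
          gcongr
          · exact hnorm _
          · exact hnorm _
      _ ≤ C₁ / y := by rw [one_mul, one_mul, mul_comm]; exact h1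
  calc _ ≤ ∑ p ∈ fareyIndex Q, ∑ p' ∈ (fareyIndex Q).filter
        (fun p' => ¬ pairRoot p * pairRoot p' = 1),
        C₁ / y * (‖1 - pairRoot p * pairRoot p'‖ ^ 2)⁻¹ :=
        norm_sum_le_of_le _ fun p hp => norm_sum_le_of_le _ (hterm p hp)
    _ = C₁ / y * ∑ p ∈ fareyIndex Q, ∑ p' ∈ (fareyIndex Q).filter
        (fun p' => ¬ pairRoot p * pairRoot p' = 1), (‖1 - pairRoot p * pairRoot p'‖ ^ 2)⁻¹ := by
        simp only [Finset.mul_sum]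
    _ ≤ C₁ / y * (C₂ * (2 * x) ^ 6) := by
        gcongr
        exact (hoff Q).trans (by gcongr)
    _ = _ := by ring

/-- Under RH, asymptotic for `C(x,y)` in the range `y ≥ x²`. -/
theorem second_moment_asymptotic_above_x_sq
    (hRH : RiemannHypothesis) (ε : ℝ) (hε : 0 < ε)
    (c₂ : ℝ) (hc₂ : 1 < c₂) (hc₂' : c₂ < 2)
    (U : ℝ) (hU : 2 ≤ U) (W : Weight U) :
    ∃ C : ℝ, 0 < C ∧ ∃ X : ℝ, ∀ x y : ℝ, X ≤ x → x ^ 2 ≤ y →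
      ‖Cxy W x y -
          ((y : ℂ) * (x : ℂ) ^ 2 / riemannZeta 2) * mellinW W.toFun 1 *
            VI c₂ (fun s => mellinW W.toFun (2 - s) * mellinW W.toFun s)‖ ≤
        C * (y * x ^ ((1 : ℝ) / 2 + ε) + y ^ ε * x ^ (4 - 2 * ε)) := by
  have hW := W.isBump hU
  rw [hW.mellinW_one, hW.VI_mellinW_mul hc₂ hc₂']
  have hη : 0 < min ε (1 / 4) := by positivity
  have hη' : min ε (1 / 4) < 1 / 2 := (min_le_right _ _).trans_lt (by norm_num)
  obtain ⟨C₁, hC₁, h₁⟩ := exists_Cxy_sub_diagonal_bound W hU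
  obtain ⟨C₂, hC₂, h₂⟩ := hW.sq.exists_totient_bound hRH hη hη'
  obtain ⟨C₃, hC₃, h₃⟩ := hW.exists_tsum_bound
  set A : ℂ := ((∫ t, W.toFun t : ℝ) : ℂ) with hA
  set J : ℂ := ((∫ t, t * W.toFun t ^ 2 : ℝ) : ℂ) with hJ
  set B : ℝ := C₁ + ‖J / riemannZeta 2‖ * C₃ with hB
  have hB0 : 0 ≤ B := by positivity
  refine ⟨C₂ * (‖A‖ + C₃) + B + 1, by positivity, 1, fun x y hx hxy => ?_⟩
  have hx0 : 0 < x := by linarith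
  have hy : 1 ≤ y := (one_le_pow₀ hx).trans hxy
  have hy0 : 0 < y := by linarith
  set D : ℂ := ∑' q : ℕ, (Nat.totient q : ℂ) * ((W.toFun (q / x) ^ 2 : ℝ) : ℂ) with hD
  set T : ℂ := ∑' n : ℕ, (W.toFun (n / y) : ℂ) with hT
  have k₁ := h₁ x y hx hy
  have k₂ := h₂ x hx
  have k₃ := h₃ y hy
  rw [← hT] at k₃
  rw [← hD, ← hT] at k₁
  rw [← hD] at k₂
  have hTn : ‖T‖ ≤ (‖A‖ + C₃) * y := by
    have : ‖T‖ ≤ ‖T - y * A‖ + ‖y * A‖ := by simpa using norm_add_le (T - y * A) (y * A)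
    rw [norm_mul, Complex.norm_real, Real.norm_of_nonneg hy0.le] at this
    nlinarith
  have hpow : x ^ (1 / 2 + min ε (1 / 4)) ≤ x ^ ((1 : ℝ) / 2 + ε) :=
    Real.rpow_le_rpow_of_exponent_le hx (by linarith [min_le_left ε (1 / 4)])
  have hx4 : x ^ 4 ≤ y ^ ε * x ^ (4 - 2 * ε) := by
    have e1 : (x ^ 2) ^ ε ≤ y ^ ε := Real.rpow_le_rpow (by positivity) hxy hε.le
    have e2 : x ^ 4 = (x ^ 2) ^ ε * x ^ (4 - 2 * ε) := by
      rw [← Real.rpow_natCast x 2, ← Real.rpow_mul hx0.le, ← Real.rpow_add hx0,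
        ← Real.rpow_natCast x 4]
      congr 1
      push_cast
      ring
    rw [e2]
    gcongr
  have hsplit : Cxy W x y - (y : ℂ) * (x : ℂ) ^ 2 / riemannZeta 2 * A * J =
      (Cxy W x y - D * T) + (D - x ^ 2 / riemannZeta 2 * J) * T +
        (J / riemannZeta 2) * x ^ 2 * (T - y * A) := by
    ring
  rw [hsplit]
  have b₁ : ‖Cxy W x y - D * T‖ ≤ C₁ * x ^ 4 := by
    refine k₁.trans (mul_le_mul_of_nonneg_left ?_ hC₁)
    rw [div_le_iff₀ hy0]
    calc x ^ 6 = x ^ 4 * x ^ 2 := by ring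
      _ ≤ x ^ 4 * y := by gcongr
  have b₂ : ‖(D - x ^ 2 / riemannZeta 2 * J) * T‖ ≤
      C₂ * (‖A‖ + C₃) * (y * x ^ ((1 : ℝ) / 2 + ε)) := by
    rw [norm_mul]
    calc _ ≤ (C₂ * x ^ ((1 : ℝ) / 2 + ε)) * ((‖A‖ + C₃) * y) := by
          gcongr
          exact k₂.trans (by gcongr)
      _ = _ := by ring
  have b₃ : ‖(J / riemannZeta 2) * x ^ 2 * (T - y * A)‖ ≤ ‖J / riemannZeta 2‖ * C₃ * x ^ 4 := by
    rw [norm_mul, norm_mul, norm_pow, Complex.norm_real, Real.norm_of_nonneg hx0.le]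
    calc _ ≤ ‖J / riemannZeta 2‖ * x ^ 4 * C₃ := by
          gcongr
          · norm_num
      _ = _ := by ring
  set E₁ := y * x ^ ((1 : ℝ) / 2 + ε) with hE₁
  set E₂ := y ^ ε * x ^ (4 - 2 * ε) with hE₂
  have p₁ : 0 ≤ E₁ := by positivity
  have p₂ : 0 ≤ E₂ := by positivity
  have hBE : B * x ^ 4 ≤ B * E₂ := by gcongr
  have hCA : 0 ≤ C₂ * (‖A‖ + C₃) := by positivity
  calc _ ≤ C₁ * x ^ 4 + C₂ * (‖A‖ + C₃) * E₁ + ‖J / riemannZeta 2‖ * C₃ * x ^ 4 :=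
        (norm_add₃_le).trans (by gcongr)
    _ = B * x ^ 4 + C₂ * (‖A‖ + C₃) * E₁ := by rw [hB]; ring
    _ ≤ B * E₂ + C₂ * (‖A‖ + C₃) * E₁ := by gcongr
    _ ≤ (C₂ * (‖A‖ + C₃) + B + 1) * (E₁ + E₂) := by
        have m₁ : 0 ≤ C₂ * (‖A‖ + C₃) * E₂ := by positivity
        have m₂ : 0 ≤ B * E₁ := by positivity
        linarith
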